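/- arXiv:1305.4238 — 2 statements merged into one kernel-verified Lean document; each statement's English description precedes it below -/
import Mathlib

section
/- Let R be a one-dimensional Cohen–Macaulay local ring with canonical module K_R and let I be a fractional ideal of R with FI = F such that I ⊗_R I^∨ is torsionfree, where I^∨ = Hom_R(I, K_R). Set B = I : I = {x ∈ F : xI ⊆ I} and let S be any intermediate ring R ⊆ S ⊆ B, with K_S = Hom_R(S, K_R). Then I ⊗_S Hom_S(I, K_S) is a torsionfree S-module and the canonical map ρ : I ⊗_R I^∨ → I ⊗_S Hom_S(I, K_S), x ⊗ f ↦ x ⊗ f, is bijective. In particular, taking S = B, the map t_B : I ⊗_B Hom_B(I, K_B) → K_B, x ⊗ f ↦ f(x), is an isomorphism of B-modules. -/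
open CategoryTheory TensorProduct

set_option synthInstance.maxHeartbeats 1000000
set_option maxHeartbeats 2000000

noncomputable section

/-- Minimal number of generators of a submodule. -/
def minGen (R : Type*) {M : Type*} [Semiring R] [AddCommMonoid M] [Module R M]
    (p : Submodule R M) : ℕ :=
  sInf {n | ∃ s : Finset M, s.card = n ∧ Submodule.span R (s : Set M) = p}

/-- Length of a module, as the height of `⊤` in its lattice of submodules. -/
def moduleLength (R M : Type*) [Ring R] [AddCommGroup M] [Module R M] : ℕ∞ :=
  Order.height (⊤ : Submodule R M)

/-- `e` is the (Hilbert–Samuel) multiplicity of the one-dimensional local ring `(R, m)`: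
the first difference of the Hilbert–Samuel function `n ↦ ℓ_R(R/mⁿ)` is eventually
equal to `e`. -/
def IsMultiplicityAt (R : Type*) [CommRing R] (m : Ideal R) (e : ℕ) : Prop :=
  ∃ N : ℕ, ∀ n ≥ N,
    moduleLength R (R ⧸ (m ^ (n + 1))) = moduleLength R (R ⧸ (m ^ n)) + e

/-- The `i`-th Ext module `Ext_R^i(M, N)`. -/
def extMod (R : Type u) [CommRing R] (M N : ModuleCat.{u} R) (i : ℕ) : ModuleCat R :=
  ((Ext R (ModuleCat.{u} R) i).obj (Opposite.op M)).obj N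

/-- `K` is a canonical module of the one-dimensional Cohen–Macaulay local ring `R` with
maximal ideal `m`, via the Bass-number characterization:
`Ext^i(R/m, K) = 0` for `i ≠ 1` and `Ext^1(R/m, K) ≅ R/m`. -/
def IsCanonicalModuleAt (R : Type u) [CommRing R] (m : Ideal R)
    (K : Type u) [AddCommGroup K] [Module R K] : Prop :=
  Module.Finite R K ∧
  (∀ i : ℕ, i ≠ 1 →
    Subsingleton (extMod R (ModuleCat.of R (R ⧸ m)) (ModuleCat.of R K) i)) ∧
  Nonempty ((extMod R (ModuleCat.of R (R ⧸ m)) (ModuleCat.of R K) 1) ≅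
    ModuleCat.of R (R ⧸ m))

/-- The evaluation map `I ⊗_R Hom_R(I, K) → K`, `x ⊗ f ↦ f x`. -/
def evalMap (R : Type*) [CommRing R] {M : Type*} [AddCommGroup M] [Module R M]
    (I : Submodule R M) (K : Type*) [AddCommGroup K] [Module R K] :
    (I ⊗[R] (I →ₗ[R] K)) →ₗ[R] K :=
  TensorProduct.lift LinearMap.applyₗ

/-- A fractional ideal `I` of `R` with `FI = F`: a finitely generated `R`-submodule of the
total ring of fractions `F = Q(R)` containing a unit of `F`. -/
def IsFracIdealUnit (R : Type*) [CommRing R] (I : Submodule R (FractionRing R)) : Prop :=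
  I.FG ∧ ∃ x ∈ I, IsUnit x

/-- A one-dimensional Cohen–Macaulay local ring: Noetherian, local, Krull dimension one,
and the maximal ideal contains a nonzerodivisor. -/
def IsOneDimCMLocal (R : Type*) [CommRing R] [IsLocalRing R] : Prop :=
  IsNoetherianRing R ∧ ringKrullDim R = 1 ∧
    ∃ x ∈ IsLocalRing.maximalIdeal R, x ∈ nonZeroDivisors R

/-- The colon `M : N = {x ∈ A | x N ⊆ M}` of two `R`-submodules of an `R`-algebra `A`,
as an `R`-submodule of `A`. -/
def colonSub {R A : Type*} [CommRing R] [CommRing A] [Algebra R A]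
    (M N : Submodule R A) : Submodule R A where
  carrier := {x : A | ∀ y ∈ N, x * y ∈ M}
  add_mem' := fun {a b} ha hb y hy => by
    rw [add_mul]; exact M.add_mem (ha y hy) (hb y hy)
  zero_mem' := fun y hy => by rw [zero_mul]; exact M.zero_mem
  smul_mem' := fun c {x} hx y hy => by
    rw [smul_mul_assoc]; exact M.smul_mem c (hx y hy)


/-- If the `R`-submodule `I` of `A` is stable under multiplication by the subalgebra `S`
(i.e. `S ⊆ I : I`), then `I` may be viewed as an `S`-submodule of `A`. -/
def restrictUp {R A : Type*} [CommRing R] [CommRing A] [Algebra R A]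
    (S : Subalgebra R A) (I : Submodule R A)
    (h : ∀ s ∈ S, ∀ y ∈ I, s * y ∈ I) : Submodule S A where
  carrier := I
  add_mem' := fun {a b} ha hb => I.add_mem ha hb
  zero_mem' := I.zero_mem
  smul_mem' := fun c {x} hx => by
    have hc : (c : A) * x ∈ I := h (c : A) c.2 x hx
    simpa [Algebra.smul_def] using hc

/-- The natural `S`-scalar action on `K_S = Hom_R(S, K)`, with `(s • f) x = f (s x)`. -/
instance canonicalHomSMul {R A : Type*} [CommRing R] [CommRing A] [Algebra R A]
    (S : Subalgebra R A) (K : Type*) [AddCommGroup K] [Module R K] :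
    SMul S (↥S →ₗ[R] K) :=
  ⟨fun s f => f ∘ₗ LinearMap.mulLeft R s⟩

theorem canonicalHomSMul_apply {R A : Type*} [CommRing R] [CommRing A] [Algebra R A]
    {S : Subalgebra R A} {K : Type*} [AddCommGroup K] [Module R K]
    (s : S) (f : ↥S →ₗ[R] K) (x : S) : (s • f) x = f (s * x) := rfl

/-- The natural `S`-module structure on `K_S = Hom_R(S, K)`, with `(s • f) x = f (s x)`. -/
instance canonicalHomModule {R A : Type*} [CommRing R] [CommRing A] [Algebra R A]
    (S : Subalgebra R A) (K : Type*) [AddCommGroup K] [Module R K] :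
    Module S (↥S →ₗ[R] K) where
  smul := (· • ·)
  one_smul f := LinearMap.ext fun x => by
    rw [canonicalHomSMul_apply, one_mul]
  mul_smul s t f := LinearMap.ext fun x => by
    rw [canonicalHomSMul_apply, canonicalHomSMul_apply, canonicalHomSMul_apply,
      mul_comm s t, mul_assoc]
  smul_zero s := LinearMap.ext fun x => rfl
  smul_add s f g := LinearMap.ext fun x => rfl
  add_smul s t f := LinearMap.ext fun x => by
    rw [LinearMap.add_apply, canonicalHomSMul_apply, canonicalHomSMul_apply,
      canonicalHomSMul_apply, add_mul, map_add]
  zero_smul f := LinearMap.ext fun x => by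
    rw [canonicalHomSMul_apply, zero_mul, map_zero, LinearMap.zero_apply]


/-- `B = I : I`, as a subalgebra of `A`. -/
def colonAlg {R A : Type*} [CommRing R] [CommRing A] [Algebra R A]
    (I : Submodule R A) : Subalgebra R A where
  carrier := {x : A | ∀ y ∈ I, x * y ∈ I}
  mul_mem' := fun {a b} ha hb y hy => by rw [mul_assoc]; exact ha _ (hb y hy)
  one_mem' := fun y hy => by rw [one_mul]; exact hy
  add_mem' := fun {a b} ha hb y hy => by
    rw [add_mul]; exact I.add_mem (ha y hy) (hb y hy)
  zero_mem' := fun y hy => by rw [zero_mul]; exact I.zero_mem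
  algebraMap_mem' := fun r y hy => by
    rw [Algebra.algebraMap_eq_smul_one, smul_mul_assoc, one_mul]
    exact I.smul_mem r hy

/-- The canonical identification `Hom_R(I, K) → Hom_S(I, K_S)`, sending `f` to the
`S`-linear map `x ↦ (s ↦ f (s x))`. -/
def homToS {R A : Type*} [CommRing R] [CommRing A] [Algebra R A]
    (S : Subalgebra R A) (I : Submodule R A)
    (h : ∀ s ∈ S, ∀ y ∈ I, s * y ∈ I)
    (K : Type*) [AddCommGroup K] [Module R K] (f : I →ₗ[R] K) :
    ↥(restrictUp S I h) →ₗ[S] (↥S →ₗ[R] K) where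
  toFun x :=
    f ∘ₗ LinearMap.codRestrict I
      ((LinearMap.mulRight R (x : A)).comp S.val.toLinearMap)
      (fun s => h s s.2 (x : A) x.2)
  map_add' x y := LinearMap.ext fun s => by
    rw [LinearMap.add_apply, LinearMap.comp_apply, LinearMap.comp_apply,
      LinearMap.comp_apply, ← map_add]
    exact congrArg f (Subtype.ext (by
      show (s : A) * ((x : A) + (y : A)) = (s : A) * (x : A) + (s : A) * (y : A)
      ring))
  map_smul' c x := LinearMap.ext fun s => by
    rw [RingHom.id_apply, canonicalHomSMul_apply, LinearMap.comp_apply,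
      LinearMap.comp_apply]
    exact congrArg f (Subtype.ext (by
      show (s : A) * ((c : A) * (x : A)) = ((c : A) * (s : A)) * (x : A)
      ring))


/-- A surjection from the cocycles of a short complex of modules onto its homology whose kernel
consists of the coboundaries. -/
theorem exists_cocycles_to_homology {R : Type u} [CommRing R]
    (S : ShortComplex (ModuleCat.{u} R)) :
    ∃ π : LinearMap.ker S.g.hom →ₗ[R] S.homology, Function.Surjective π ∧
      ∀ z, π z = 0 ↔ ∃ y, S.f.hom y = (z : S.X₂) := by
  refine ⟨S.moduleCatHomologyIso.inv.hom ∘ₗ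
    (LinearMap.range (S.moduleCatToCycles)).mkQ, ?_, ?_⟩
  · exact S.moduleCatHomologyIso.symm.toLinearEquiv.surjective.comp
      (LinearMap.range (S.moduleCatToCycles)).mkQ_surjective
  · intro z
    have h : (S.moduleCatHomologyIso.inv.hom ∘ₗ
        (LinearMap.range (S.moduleCatToCycles)).mkQ) z = 0 ↔
        (LinearMap.range (S.moduleCatToCycles)).mkQ z = 0 :=
      S.moduleCatHomologyIso.symm.toLinearEquiv.map_eq_zero_iff
    rw [h, Submodule.mkQ_apply, Submodule.Quotient.mk_eq_zero, LinearMap.mem_range]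
    exact exists_congr fun y => Subtype.ext_iff

/-- A cocycle of a complex of modules with vanishing homology is a coboundary. -/
theorem exists_coboundary_of_subsingleton {R : Type u} [CommRing R]
    (C : CochainComplex (ModuleCat.{u} R) ℕ) (i j k : ℕ)
    (hi : (ComplexShape.up ℕ).prev j = i) (hk : (ComplexShape.up ℕ).next j = k)
    (h : Subsingleton (C.homology j)) (z : C.X j) (hz : (C.d j k).hom z = 0) :
    ∃ y, (C.d i j).hom y = z := by
  obtain ⟨π, -, hπ⟩ := exists_cocycles_to_homology (C.sc' i j k)
  have : Subsingleton (C.sc' i j k).homology :=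
    (C.homologyIsoSc' i j k hi hk).symm.toLinearEquiv.toEquiv.subsingleton
  exact (hπ ⟨z, hz⟩).1 (Subsingleton.elim _ _)

/-- In a complex of modules whose homology is isomorphic to a residue field, there is a cocycle
which is not a coboundary, and it generates all cocycles modulo coboundaries. -/
theorem cocycle_dichotomy_of_homology_iso {R : Type u} [CommRing R] (m : Ideal R) [m.IsMaximal]
    (C : CochainComplex (ModuleCat.{u} R) ℕ) (i j k : ℕ)
    (hi : (ComplexShape.up ℕ).prev j = i) (hk : (ComplexShape.up ℕ).next j = k)
    (e : C.homology j ≅ ModuleCat.of R (R ⧸ m)) :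
    Nontrivial (C.X j) ∧ ∀ z₁ z₂ : C.X j, (C.d j k).hom z₁ = 0 → (C.d j k).hom z₂ = 0 →
      (∃ y, (C.d i j).hom y = z₁) ∨ ∃ (r : R) (y : _), (C.d i j).hom y = z₂ - r • z₁ := by
  obtain ⟨π, hs, hπ⟩ := exists_cocycles_to_homology (C.sc' i j k)
  let e' : (C.sc' i j k).homology ≃ₗ[R] R ⧸ m :=
    ((C.homologyIsoSc' i j k hi hk).symm ≪≫ e).toLinearEquiv
  constructor
  · obtain ⟨z, hz⟩ := hs (e'.symm 1)
    refine ⟨⟨z.1, 0, fun h0 => ?_⟩⟩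
    have h1 : z = 0 := Subtype.ext h0
    rw [h1, map_zero, eq_comm, LinearEquiv.map_eq_zero_iff] at hz
    exact one_ne_zero hz
  · intro z₁ z₂ h₁ h₂
    by_cases h0 : π ⟨z₁, h₁⟩ = 0
    · exact Or.inl ((hπ _).1 h0)
    right
    obtain ⟨a, ha⟩ := Ideal.Quotient.mk_surjective (e' (π ⟨z₁, h₁⟩))
    obtain ⟨b, hb⟩ := Ideal.Quotient.mk_surjective (e' (π ⟨z₂, h₂⟩))
    have ham : Ideal.Quotient.mk m a ≠ 0 := by
      rw [ha]; exact fun h => h0 (e'.map_eq_zero_iff.1 h)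
    let _ := Ideal.Quotient.field m
    obtain ⟨c, hc⟩ := Ideal.Quotient.mk_surjective ((Ideal.Quotient.mk m a)⁻¹)
    refine ⟨b * c, ?_⟩
    have key : π (⟨z₂, h₂⟩ - (b * c) • ⟨z₁, h₁⟩) = 0 := by
      apply e'.injective
      rw [map_sub, map_sub, map_smul, map_smul, map_zero, ← ha, ← hb, sub_eq_zero,
        Algebra.smul_def, Ideal.Quotient.algebraMap_eq, map_mul, hc, mul_assoc,
        inv_mul_cancel₀ ham, mul_one]
    exact (hπ _).1 key

/-- The defining properties of a canonical module, expressed on the start of a projective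
resolution `P₁ → P₀ → R/m → 0` of the residue field. -/
theorem IsCanonicalModuleAt.exists_presentation {R : Type u} [CommRing R] {m : Ideal R}
    [m.IsMaximal] {K : Type u} [AddCommGroup K] [Module R K] (hK : IsCanonicalModuleAt R m K) :
    Nontrivial K ∧
    ∃ (P₀ P₁ : Type u) (_ : AddCommGroup P₀) (_ : AddCommGroup P₁) (_ : Module R P₀)
      (_ : Module R P₁) (ε : P₀ →ₗ[R] R ⧸ m) (δ : P₁ →ₗ[R] P₀),
      Module.Projective R P₀ ∧ Module.Projective R P₁ ∧ Function.Surjective ε ∧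
      Function.Exact δ ε ∧
      (∀ G : P₀ →ₗ[R] K, G ∘ₗ δ = 0 → G = 0) ∧
      (∀ c₁ c₂ : P₁ →ₗ[R] K, (∀ z, δ z = 0 → c₁ z = 0) → (∀ z, δ z = 0 → c₂ z = 0) →
        (∃ G : P₀ →ₗ[R] K, G ∘ₗ δ = c₁) ∨ ∃ (r : R) (G : P₀ →ₗ[R] K), G ∘ₗ δ = c₂ - r • c₁) ∧
      (∀ g : LinearMap.ker δ →ₗ[R] K, ∃ G : P₁ →ₗ[R] K, ∀ z : LinearMap.ker δ, G z = g z) := by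
  obtain ⟨-, hE, ⟨e⟩⟩ := hK
  let P := projectiveResolution (ModuleCat.of R (R ⧸ m))
  let Y := ModuleCat.of R K
  have h0 : Subsingleton ((P.complex.linearYonedaObj R Y).homology 0) :=
    have : Subsingleton (((Ext R (ModuleCat.{u} R) 0).obj
      (Opposite.op (ModuleCat.of R (R ⧸ m)))).obj Y) := hE 0 (by decide)
    (P.isoExt 0 Y).symm.toLinearEquiv.toEquiv.subsingleton
  have h2 : Subsingleton ((P.complex.linearYonedaObj R Y).homology 2) :=
    have : Subsingleton (((Ext R (ModuleCat.{u} R) 2).obj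
      (Opposite.op (ModuleCat.of R (R ⧸ m)))).obj Y) := hE 2 (by decide)
    (P.isoExt 2 Y).symm.toLinearEquiv.toEquiv.subsingleton
  obtain ⟨hN, hD⟩ := cocycle_dichotomy_of_homology_iso m (P.complex.linearYonedaObj R Y) 0 1 2
    (by simp) (by simp) ((P.isoExt 1 Y).symm ≪≫ e)
  have ex0 := ((ShortComplex.moduleCat_exact_iff _).1 P.exact₀)
  have ex1 := ((ShortComplex.moduleCat_exact_iff _).1 (P.exact_succ 0))
  have d10 (z) : (P.π.f 0).hom ((P.complex.d 1 0).hom z) = 0 :=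
    LinearMap.congr_fun (congrArg ModuleCat.Hom.hom P.complex_d_comp_π_f_zero) z
  have d21 (z) : (P.complex.d 1 0).hom ((P.complex.d 2 1).hom z) = 0 :=
    LinearMap.congr_fun (congrArg ModuleCat.Hom.hom (P.complex.d_comp_d 2 1 0)) z
  have d32 (z) : (P.complex.d 2 1).hom ((P.complex.d 3 2).hom z) = 0 :=
    LinearMap.congr_fun (congrArg ModuleCat.Hom.hom (P.complex.d_comp_d 3 2 1)) z
  have hpi : Function.Surjective (P.π.f 0).hom := (ModuleCat.epi_iff_surjective _).1 inferInstance
  refine ⟨?_, P.complex.X 0, P.complex.X 1, inferInstance, inferInstance, inferInstance,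
    inferInstance, (P.π.f 0).hom, (P.complex.d 1 0).hom, ?_, ?_, hpi, ?_, ?_, ?_, ?_⟩
  · by_contra hK
    rw [not_nontrivial_iff_subsingleton] at hK
    obtain ⟨a, b, hab⟩ := hN
    refine hab (ModuleCat.hom_ext (LinearMap.ext fun z => ?_) : (a : P.complex.X 1 ⟶ Y) = b)
    exact Subsingleton.elim (α := K) _ _
  · have := P.projective 0
    infer_instance
  · have := P.projective 1
    infer_instance
  · intro z
    constructor
    · intro hz
      exact ex0 z hz
    · rintro ⟨y, rfl⟩
      exact d10 y
  · intro G hG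
    obtain ⟨y, hy⟩ := exists_coboundary_of_subsingleton _ 0 0 1 (by simp) (by simp) h0
      (ModuleCat.ofHom G : P.complex.X 0 ⟶ Y) (by
        exact ModuleCat.hom_ext hG)
    rw [HomologicalComplex.shape _ 0 0 (by simp)] at hy
    exact (congrArg (fun f : P.complex.X 0 ⟶ Y => f.hom) hy).symm
  · intro c₁ c₂ hc₁ hc₂
    have := hD (ModuleCat.ofHom c₁ : P.complex.X 1 ⟶ Y) (ModuleCat.ofHom c₂ : P.complex.X 1 ⟶ Y)
      (ModuleCat.hom_ext (LinearMap.ext fun z => hc₁ _ (d21 z)))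
      (ModuleCat.hom_ext (LinearMap.ext fun z => hc₂ _ (d21 z)))
    rcases this with ⟨G, hG⟩ | ⟨r, G, hG⟩
    · exact Or.inl ⟨ModuleCat.Hom.hom (G : P.complex.X 0 ⟶ Y),
        congrArg (fun f : P.complex.X 1 ⟶ Y => f.hom) hG⟩
    · exact Or.inr ⟨r, ModuleCat.Hom.hom (G : P.complex.X 0 ⟶ Y),
        congrArg (fun f : P.complex.X 1 ⟶ Y => f.hom) hG⟩
  · intro g
    let c : P.complex.X 2 →ₗ[R] K :=
      g ∘ₗ LinearMap.codRestrict _ (P.complex.d 2 1).hom fun z => d21 z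
    have hc (z) : c ((P.complex.d 3 2).hom z) = 0 := by
      have : LinearMap.codRestrict (LinearMap.ker (P.complex.d 1 0).hom) (P.complex.d 2 1).hom
          (fun z => d21 z) ((P.complex.d 3 2).hom z) = 0 := Subtype.ext (d32 z)
      rw [LinearMap.comp_apply, this, map_zero]
    obtain ⟨G, hG⟩ := exists_coboundary_of_subsingleton _ 1 2 3 (by simp) (by simp) h2
      (ModuleCat.ofHom c : P.complex.X 2 ⟶ Y) (ModuleCat.hom_ext (LinearMap.ext hc))
    refine ⟨ModuleCat.Hom.hom (G : P.complex.X 1 ⟶ Y), fun z => ?_⟩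
    obtain ⟨y, hy⟩ := ex1 z.1 z.2
    have hG' : ∀ y, ModuleCat.Hom.hom (G : P.complex.X 1 ⟶ Y) ((P.complex.d 2 1).hom y) = c y :=
      fun y => congrArg (fun f : P.complex.X 2 ⟶ Y => f.hom y) hG
    have h3 : (z : P.complex.X 1) = (P.complex.d 2 1).hom y := hy.symm
    rw [h3, hG']
    exact congrArg g (Subtype.ext hy)

/-- A linear map vanishing on the kernel of a surjection factors through it. -/
theorem exists_linearMap_of_ker_le {R : Type*} [CommRing R] {P M N : Type*} [AddCommGroup P]
    [AddCommGroup M] [AddCommGroup N] [Module R P] [Module R M] [Module R N]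
    {p : P →ₗ[R] M} (hp : Function.Surjective p) (g : P →ₗ[R] N)
    (h : ∀ z, p z = 0 → g z = 0) : ∃ g' : M →ₗ[R] N, ∀ z, g' (p z) = g z := by
  have hle : LinearMap.ker p ≤ LinearMap.ker g := fun z hz => h z hz
  refine ⟨(LinearMap.ker p).liftQ g hle ∘ₗ (p.quotKerEquivOfSurjective hp).symm.toLinearMap,
    fun z => ?_⟩
  have : (p.quotKerEquivOfSurjective hp).symm (p z) = (LinearMap.ker p).mkQ z := by
    rw [LinearEquiv.symm_apply_eq]; rfl
  rw [LinearMap.comp_apply, LinearEquiv.coe_coe, this, Submodule.mkQ_apply, Submodule.liftQ_apply]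

/-- A linear map with values in the multiples of an element `x` regular on the target can be
divided by `x`. -/
theorem exists_smul_eq_of_forall_exists {R : Type*} [CommRing R] {N K : Type*} [AddCommGroup N]
    [AddCommGroup K] [Module R N] [Module R K] {x : R} (hx : ∀ κ : K, x • κ = 0 → κ = 0)
    (H : N →ₗ[R] K) (h : ∀ n, ∃ κ : K, x • κ = H n) : ∃ g : N →ₗ[R] K, ∀ n, x • g n = H n := by
  have inj (a b : K) (hab : x • a = x • b) : a = b :=
    sub_eq_zero.1 (hx _ (by rw [smul_sub, hab, sub_self]))
  choose g hg using h
  refine ⟨⟨⟨g, fun a b => inj _ _ ?_⟩, fun r a => inj _ _ ?_⟩, hg⟩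
  · rw [smul_add, hg, hg, hg, map_add]
  · rw [RingHom.id_apply, hg, smul_comm, hg, map_smul]

/-- If every map from the kernel of `P → M` to `K` extends to the projective module `P`, then maps
`M → E` lift along a surjection `q : K → E` with kernel `xK`. -/
theorem exists_lift_of_forall_extends {R : Type*} [CommRing R] {P M K E : Type*} [AddCommGroup P]
    [AddCommGroup M] [AddCommGroup K] [AddCommGroup E] [Module R P] [Module R M] [Module R K]
    [Module R E] [Module.Projective R P] {p : P →ₗ[R] M} (hp : Function.Surjective p) {x : R}
    (hx : ∀ κ : K, x • κ = 0 → κ = 0) {q : K →ₗ[R] E} (hq : Function.Surjective q)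
    (hqx : ∀ κ, q κ = 0 ↔ ∃ κ', x • κ' = κ)
    (hext : ∀ g : LinearMap.ker p →ₗ[R] K, ∃ G : P →ₗ[R] K, ∀ z : LinearMap.ker p, G z = g z)
    (h : M →ₗ[R] E) : ∃ h' : M →ₗ[R] K, ∀ y, q (h' y) = h y := by
  obtain ⟨H, hH⟩ := Module.projective_lifting_property q (h ∘ₗ p) hq
  have hH' (z) : q (H z) = h (p z) := LinearMap.congr_fun hH z
  obtain ⟨g, hg⟩ := exists_smul_eq_of_forall_exists hx (H ∘ₗ (LinearMap.ker p).subtype)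
    fun z => (hqx _).1 (by
      rw [LinearMap.comp_apply, Submodule.subtype_apply, hH', LinearMap.mem_ker.1 z.2, map_zero])
  obtain ⟨G, hG⟩ := hext g
  obtain ⟨h', hh'⟩ := exists_linearMap_of_ker_le hp (H - x • G) fun z hz => by
    have := hg ⟨z, hz⟩
    rw [← hG] at this
    rw [LinearMap.sub_apply, LinearMap.smul_apply, this]
    exact sub_self _
  refine ⟨h', fun y => ?_⟩
  obtain ⟨z, rfl⟩ := hp y
  have : q (x • G z) = 0 := (hqx _).2 ⟨_, rfl⟩
  rw [hh', LinearMap.sub_apply, map_sub, LinearMap.smul_apply, this, sub_zero, hH']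

/-- In a ring of dimension at most one, a prime containing a nonzerodivisor is maximal. -/
theorem Ideal.IsPrime.isMaximal_of_mem_nonZeroDivisors {R : Type*} [CommRing R]
    (hdim : ringKrullDim R ≤ 1) {x : R} (hx : x ∈ nonZeroDivisors R) {p : Ideal R}
    (hp : p.IsPrime) (hxp : x ∈ p) : p.IsMaximal := by
  have : Ring.KrullDimLE 1 R := Order.krullDimLE_iff 1 _ |>.2 hdim
  refine ((Ring.krullDimLE_one_iff.1 this) p hp).resolve_left fun h => ?_
  exact notMem_nonZeroDivisors_of_mem_mem_minimalPrimes hxp h hx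

/-- Over a one-dimensional noetherian local ring, a nonzero module killed by a nonzerodivisor
has a nonzero element killed by the maximal ideal (stated for a quotient `X/N`). -/
theorem exists_notMem_forall_smul_mem {R : Type*} [CommRing R] [IsNoetherianRing R]
    [IsLocalRing R] (hdim : ringKrullDim R ≤ 1) {x : R} (hx : x ∈ nonZeroDivisors R)
    {X : Type*} [AddCommGroup X] [Module R X] {N : Submodule R X} (hN : N ≠ ⊤)
    (hxN : ∀ y : X, x • y ∈ N) :
    ∃ z ∉ N, ∀ r ∈ IsLocalRing.maximalIdeal R, r • z ∈ N := by
  have : Nontrivial (X ⧸ N) := Submodule.Quotient.nontrivial_iff.2 hN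
  obtain ⟨p, hp⟩ := associatedPrimes.nonempty R (X ⧸ N)
  obtain ⟨hpp, z, hz⟩ := (Submodule.isAssociatedPrime_iff).1 hp
  obtain ⟨z, rfl⟩ := N.mkQ_surjective z
  have hmem (r : R) : r ∈ p ↔ r • z ∈ N := by
    rw [hz, Submodule.mem_colon_singleton, Submodule.mem_bot, ← map_smul, Submodule.mkQ_apply,
      Submodule.Quotient.mk_eq_zero]
  have hmax := hpp.isMaximal_of_mem_nonZeroDivisors hdim hx ((hmem x).2 (hxN z))
  obtain rfl := IsLocalRing.eq_maximalIdeal hmax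
  refine ⟨z, fun h => hpp.one_notMem ((hmem 1).2 (by rwa [one_smul])), fun r hr => (hmem r).1 hr⟩

/-- Nakayama's lemma for a single element of the maximal ideal. -/
theorem Submodule.eq_top_of_forall_exists_add_smul {R : Type*} [CommRing R] [IsLocalRing R]
    {M : Type*} [AddCommGroup M] [Module R M] [Module.Finite R M] {x : R}
    (hx : x ∈ IsLocalRing.maximalIdeal R) (N : Submodule R M)
    (h : ∀ y : M, ∃ n ∈ N, ∃ z : M, y = n + x • z) : N = ⊤ := by
  rw [eq_top_iff]
  refine Submodule.le_of_le_smul_of_le_jacobson_bot (I := IsLocalRing.maximalIdeal R)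
    Module.Finite.fg_top (IsLocalRing.maximalIdeal_le_jacobson _) fun y _ => ?_
  obtain ⟨n, hn, z, rfl⟩ := h y
  exact Submodule.add_mem_sup hn (Submodule.smul_mem_smul hx trivial)

/-- `E` is a module over `R/xR` which has a simple socle and satisfies Baer's criterion with
respect to the maximal ideal; when `R/xR` is artinian it is an injective hull of the residue
field over `R/xR`. -/
structure IsInjectiveHullMod {R : Type*} [CommRing R] [IsLocalRing R] (x : R) (E : Type*)
    [AddCommGroup E] [Module R E] : Prop where
  smul_eq_zero : ∀ e : E, x • e = 0
  baer : ∀ h : IsLocalRing.maximalIdeal R →ₗ[R] E,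
    (∀ r : IsLocalRing.maximalIdeal R, (r : R) = x → h r = 0) →
    ∃ e : E, ∀ r : IsLocalRing.maximalIdeal R, h r = (r : R) • e
  exists_socle : ∃ e : E, e ≠ 0 ∧ ∀ r ∈ IsLocalRing.maximalIdeal R, r • e = 0
  socle_cyclic : ∀ e₁ e₂ : E, (∀ r ∈ IsLocalRing.maximalIdeal R, r • e₁ = 0) →
    (∀ r ∈ IsLocalRing.maximalIdeal R, r • e₂ = 0) → e₁ ≠ 0 → ∃ r : R, e₂ = r • e₁

namespace IsInjectiveHullMod

variable {R : Type*} [CommRing R] [IsNoetherianRing R] [IsLocalRing R] {x : R} {E : Type*}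
  [AddCommGroup E] [Module R E]

/-- Extension of maps to `E` from a submodule containing `xX`. -/
theorem exists_extension_of_smul_mem (hE : IsInjectiveHullMod x E) (hdim : ringKrullDim R ≤ 1)
    (hx : x ∈ nonZeroDivisors R) {X : Type*}
    [AddCommGroup X] [Module R X] [Module.Finite R X] (N : Submodule R X)
    (hxN : ∀ y : X, x • y ∈ N) (g : N →ₗ[R] E) (hg : ∀ y, g ⟨x • y, hxN y⟩ = 0) :
    ∃ G : X →ₗ[R] E, ∀ n : N, G n = g n := by
  induction N using WellFoundedGT.induction with
  | ind N ih =>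
    by_cases hN : N = ⊤
    · subst hN
      exact ⟨g ∘ₗ Submodule.topEquiv.symm.toLinearMap, fun n => rfl⟩
    obtain ⟨z, hz, hmz⟩ := exists_notMem_forall_smul_mem hdim hx hN hxN
    let mul : IsLocalRing.maximalIdeal R →ₗ[R] N :=
      LinearMap.codRestrict N
        ((LinearMap.toSpanSingleton R X z) ∘ₗ (IsLocalRing.maximalIdeal R).subtype)
        fun r => hmz r r.2
    obtain ⟨e, he⟩ := hE.baer (g ∘ₗ mul) (by
      rintro ⟨r, hr⟩ rfl
      exact hg z)
    let N' := N ⊔ Submodule.span R {z}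
    have hzN' : z ∈ N' := Submodule.mem_sup_right (Submodule.mem_span_singleton_self z)
    let p : (N × R) →ₗ[R] N' :=
      LinearMap.coprod (Submodule.inclusion le_sup_left)
        (LinearMap.toSpanSingleton R N' ⟨z, hzN'⟩)
    have hp : Function.Surjective p := by
      rintro ⟨y, hy⟩
      obtain ⟨n, hn, w, hw, rfl⟩ := Submodule.mem_sup.1 hy
      obtain ⟨r, rfl⟩ := Submodule.mem_span_singleton.1 hw
      exact ⟨(⟨n, hn⟩, r), rfl⟩
    obtain ⟨g', hg'⟩ := exists_linearMap_of_ker_le hp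
      (LinearMap.coprod g (LinearMap.toSpanSingleton R E e)) (by
        rintro ⟨n, r⟩ h0
        have h1 : (n : X) + r • z = 0 := congrArg Subtype.val h0
        have h2 : r • z = -n := by rw [eq_neg_iff_add_eq_zero, add_comm, h1]
        have hr : r ∈ IsLocalRing.maximalIdeal R := by
          rw [IsLocalRing.mem_maximalIdeal, mem_nonunits_iff]
          intro hu
          refine hz ((Submodule.smul_mem_iff_of_isUnit N hu).1 ?_)
          rw [h2]
          exact N.neg_mem n.2
        have h3 : mul ⟨r, hr⟩ = -n := Subtype.ext h2
        have h4 := he ⟨r, hr⟩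
        rw [LinearMap.comp_apply, h3, map_neg] at h4
        rw [LinearMap.coprod_apply, LinearMap.toSpanSingleton_apply, ← h4, add_neg_cancel])
    have hext (n : N) : g' ⟨n, Submodule.mem_sup_left n.2⟩ = g n := by
      have : p (n, 0) = ⟨n, Submodule.mem_sup_left n.2⟩ := Subtype.ext (by simp [p])
      rw [← this, hg', LinearMap.coprod_apply, map_zero, add_zero]
    obtain ⟨G, hG⟩ := ih N' (lt_of_le_of_ne le_sup_left fun h => hz (h ▸ hzN'))
      (fun y => Submodule.mem_sup_left (hxN y)) g' fun y => by
        rw [← hg y, ← hext ⟨x • y, hxN y⟩]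
    exact ⟨G, fun n => by rw [← hext, ← hG]⟩

/-- Extension of maps to `E` from a submodule `N` of `X` which vanish on `N ∩ xX`. -/
theorem exists_extension (hE : IsInjectiveHullMod x E) (hdim : ringKrullDim R ≤ 1)
    (hx : x ∈ nonZeroDivisors R) {X : Type*}
    [AddCommGroup X] [Module R X] [Module.Finite R X] (N : Submodule R X)
    (g : N →ₗ[R] E) (hg : ∀ (n : N) (y : X), (n : X) = x • y → g n = 0) :
    ∃ G : X →ₗ[R] E, ∀ n : N, G n = g n := by
  let T : Submodule R X := LinearMap.range (LinearMap.lsmul R X x)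
  let p : (N × T) →ₗ[R] ↥(N ⊔ T) :=
    LinearMap.coprod (Submodule.inclusion le_sup_left) (Submodule.inclusion le_sup_right)
  have hp : Function.Surjective p := by
    rintro ⟨y, hy⟩
    obtain ⟨n, hn, w, hw, rfl⟩ := Submodule.mem_sup.1 hy
    exact ⟨(⟨n, hn⟩, ⟨w, hw⟩), rfl⟩
  obtain ⟨g', hg'⟩ := exists_linearMap_of_ker_le hp (LinearMap.coprod g 0) (by
    rintro ⟨n, ⟨-, y, rfl⟩⟩ h0
    have h1 : (n : X) + x • y = 0 := congrArg Subtype.val h0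
    rw [LinearMap.coprod_apply, LinearMap.zero_apply, add_zero]
    exact hg n (-y) (by rw [smul_neg, eq_neg_iff_add_eq_zero, h1]))
  have hT (y : X) : x • y ∈ N ⊔ T := Submodule.mem_sup_right ⟨y, rfl⟩
  obtain ⟨G, hG⟩ := hE.exists_extension_of_smul_mem hdim hx (N ⊔ T) hT g' fun y => by
    have : p (0, ⟨x • y, ⟨y, rfl⟩⟩) = ⟨x • y, hT y⟩ := Subtype.ext (by simp [p])
    rw [← this, hg', LinearMap.coprod_apply, map_zero, LinearMap.zero_apply, add_zero]
  refine ⟨G, fun n => ?_⟩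
  have : p (n, 0) = ⟨n, Submodule.mem_sup_left n.2⟩ := Subtype.ext (by simp [p])
  refine (hG ⟨n, Submodule.mem_sup_left n.2⟩).trans ?_
  rw [← this, hg', LinearMap.coprod_apply, map_zero, add_zero]

/-- `E` cogenerates finite modules modulo `x`. -/
theorem exists_apply_ne_zero (hE : IsInjectiveHullMod x E) (hdim : ringKrullDim R ≤ 1)
    (hx : x ∈ nonZeroDivisors R) {X : Type*}
    [AddCommGroup X] [Module R X] [Module.Finite R X] (c : X) (hc : ∀ y, c ≠ x • y) :
    ∃ h : X →ₗ[R] E, h c ≠ 0 := by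
  obtain ⟨σ, hσ, hmσ⟩ := hE.exists_socle
  have key (r : R) (y : X) (hr : r • c = x • y) : r • σ = 0 := by
    refine hmσ r ?_
    rw [IsLocalRing.mem_maximalIdeal, mem_nonunits_iff]
    rintro ⟨u, rfl⟩
    refine hc ((↑u⁻¹ : R) • y) ?_
    rw [smul_comm, ← hr, smul_smul, Units.inv_mul, one_smul]
  let N : Submodule R X := Submodule.span R {c}
  have hcN : c ∈ N := Submodule.mem_span_singleton_self c
  let p : R →ₗ[R] N := LinearMap.toSpanSingleton R N ⟨c, hcN⟩
  have hp : Function.Surjective p := by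
    rintro ⟨y, hy⟩
    obtain ⟨r, rfl⟩ := Submodule.mem_span_singleton.1 hy
    exact ⟨r, rfl⟩
  obtain ⟨g, hg⟩ := exists_linearMap_of_ker_le hp (LinearMap.toSpanSingleton R E σ) fun r hr =>
    key r 0 ((congrArg Subtype.val hr).trans (smul_zero x).symm)
  obtain ⟨G, hG⟩ := hE.exists_extension hdim hx N g fun n y hn => by
    obtain ⟨r, rfl⟩ := hp n
    rw [hg]
    exact key r y hn
  refine ⟨G, ?_⟩
  have h1 : p 1 = ⟨c, hcN⟩ := Subtype.ext (one_smul R c)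
  have h2 := hG (p 1)
  rw [hg, h1, LinearMap.toSpanSingleton_apply, one_smul] at h2
  rwa [h2]

/-- Matlis reflexivity: functionals on `Hom(X, E)` are evaluations. -/
theorem exists_eq_apply (hE : IsInjectiveHullMod x E) (hdim : ringKrullDim R ≤ 1)
    (hx : x ∈ nonZeroDivisors R) {X : Type*}
    [AddCommGroup X] [Module R X] [Module.Finite R X] (φ : (X →ₗ[R] E) →ₗ[R] E) :
    ∃ c : X, ∀ f, φ f = f c := by
  have main (N : Submodule R X) (hxN : ∀ y : X, x • y ∈ N) (hN : ∀ ψ : (X →ₗ[R] E) →ₗ[R] E,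
      (∀ f : X →ₗ[R] E, (∀ n ∈ N, f n = 0) → ψ f = 0) → ∃ c : X, ∀ f, ψ f = f c) :
      ∃ c : X, ∀ f, φ f = f c := by
    induction N using WellFoundedGT.induction with
    | ind N ih =>
      by_cases hNt : N = ⊤
      · subst hNt
        refine hN φ fun f hf => ?_
        rw [show f = 0 from LinearMap.ext fun n => hf n trivial, map_zero]
      obtain ⟨z, hz, hmz⟩ := exists_notMem_forall_smul_mem hdim hx hNt hxN
      have hzN' : z ∈ N ⊔ Submodule.span R {z} :=
        Submodule.mem_sup_right (Submodule.mem_span_singleton_self z)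
      have vanish (f : X →ₗ[R] E) (hf : ∀ n ∈ N, f n = 0) (hfz : f z = 0) :
          ∀ n ∈ N ⊔ Submodule.span R {z}, f n = 0 := by
        intro n hn
        obtain ⟨y, hy, w, hw, rfl⟩ := Submodule.mem_sup.1 hn
        obtain ⟨r, rfl⟩ := Submodule.mem_span_singleton.1 hw
        rw [map_add, map_smul, hf y hy, hfz, smul_zero, add_zero]
      have soc (f : X →ₗ[R] E) (hf : ∀ n ∈ N, f n = 0) :
          ∀ r ∈ IsLocalRing.maximalIdeal R, r • f z = 0 := fun r hr => by
        rw [← map_smul, hf _ (hmz r hr)]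
      refine ih (N ⊔ Submodule.span R {z})
        (lt_of_le_of_ne le_sup_left fun h => hz (h ▸ hzN'))
        (fun y => Submodule.mem_sup_left (hxN y)) fun ψ hψ => ?_
      by_cases hf : ∀ f : X →ₗ[R] E, (∀ n ∈ N, f n = 0) → f z = 0
      · exact hN ψ fun f hfN => hψ f (vanish f hfN (hf f hfN))
      push Not at hf
      obtain ⟨f₀, hf₀, hf₀z⟩ := hf
      obtain ⟨r, hr⟩ := hE.socle_cyclic (f₀ z) (ψ f₀) (soc f₀ hf₀) (fun s hs => by
        rw [← map_smul]
        refine hψ _ (vanish _ (fun n hn => ?_) ?_)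
        · rw [LinearMap.smul_apply, hf₀ n hn, smul_zero]
        · rw [LinearMap.smul_apply, soc f₀ hf₀ s hs]) hf₀z
      obtain ⟨c, hc⟩ := hN (ψ - r • LinearMap.applyₗ z) fun f hfN => by
        obtain ⟨t, ht⟩ := hE.socle_cyclic (f₀ z) (f z) (soc f₀ hf₀) (soc f hfN) hf₀z
        have h0 : ψ (f - t • f₀) = 0 := hψ _ (vanish _ (fun n hn => by
          rw [LinearMap.sub_apply, LinearMap.smul_apply, hfN n hn, hf₀ n hn, smul_zero, sub_zero])
          (by rw [LinearMap.sub_apply, LinearMap.smul_apply, ht, sub_self]))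
        rw [map_sub, map_smul, hr, sub_eq_zero] at h0
        rw [LinearMap.sub_apply, LinearMap.smul_apply, h0]
        show t • r • f₀ z - r • f z = 0
        rw [ht, smul_comm, sub_self]
      refine ⟨c + r • z, fun f => ?_⟩
      have := hc f
      rw [LinearMap.sub_apply, LinearMap.smul_apply, sub_eq_iff_eq_add] at this
      rw [this, map_add, map_smul]
      rfl
  refine main (LinearMap.range (LinearMap.lsmul R X x)) (fun y => ⟨y, rfl⟩) fun ψ hψ => ⟨0, ?_⟩
  intro f
  rw [map_zero]
  refine hψ f ?_
  rintro _ ⟨y, rfl⟩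
  rw [LinearMap.lsmul_apply, map_smul, hE.smul_eq_zero]

end IsInjectiveHullMod

namespace IsCanonicalModuleAt

variable {R : Type u} [CommRing R] [IsLocalRing R] {K : Type u} [AddCommGroup K] [Module R K]

theorem eq_zero_of_forall_smul (hK : IsCanonicalModuleAt R (IsLocalRing.maximalIdeal R) K) (κ : K)
    (h : ∀ r ∈ IsLocalRing.maximalIdeal R, r • κ = 0) : κ = 0 := by
  obtain ⟨-, P₀, P₁, _, _, _, _, ε, δ, -, -, hε, hex, h0, -⟩ := hK.exists_presentation
  obtain ⟨σ, hσ⟩ := exists_linearMap_of_ker_le (IsLocalRing.maximalIdeal R).mkQ_surjective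
    (LinearMap.toSpanSingleton R K κ) fun r hr => h r (by
      rwa [Submodule.mkQ_apply, Submodule.Quotient.mk_eq_zero] at hr)
  have hz := h0 (σ ∘ₗ ε) (LinearMap.ext fun y => by
    rw [LinearMap.comp_apply, LinearMap.comp_apply, (hex (δ y)).2 ⟨y, rfl⟩, map_zero,
      LinearMap.zero_apply])
  obtain ⟨p, hp⟩ := hε ((IsLocalRing.maximalIdeal R).mkQ 1)
  have := LinearMap.congr_fun hz p
  rw [LinearMap.comp_apply, hp, hσ, LinearMap.toSpanSingleton_apply, one_smul] at this
  exact this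

/-- Canonical modules are torsionfree. -/
theorem smul_eq_zero [IsNoetherianRing R]
    (hK : IsCanonicalModuleAt R (IsLocalRing.maximalIdeal R) K)
    (hdim : ringKrullDim R ≤ 1) {d : R} (hd : d ∈ nonZeroDivisors R) (κ : K) (h : d • κ = 0) :
    κ = 0 := by
  by_contra hκ
  let T := LinearMap.ker (LinearMap.lsmul R K d)
  have hT : (⊥ : Submodule R T) ≠ ⊤ := fun hbt => by
    have : (⟨κ, h⟩ : T) ∈ (⊥ : Submodule R T) := hbt ▸ trivial
    exact hκ (congrArg Subtype.val ((Submodule.mem_bot R).1 this))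
  obtain ⟨z, hz, hmz⟩ := exists_notMem_forall_smul_mem hdim hd hT
    fun y => (Submodule.mem_bot R).2 (Subtype.ext y.2)
  refine hz ((Submodule.mem_bot R).2 (Subtype.ext (hK.eq_zero_of_forall_smul _ fun r hr => ?_)))
  exact congrArg Subtype.val ((Submodule.mem_bot R).1 (hmz r hr))

/-- The reduction of a canonical module modulo a regular element `x` of the maximal ideal is an
injective hull of the residue field over `R/xR`. -/
theorem isInjectiveHullMod [IsNoetherianRing R]
    (hK : IsCanonicalModuleAt R (IsLocalRing.maximalIdeal R) K)
    (hdim : ringKrullDim R ≤ 1) {x : R} (hx : x ∈ nonZeroDivisors R)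
    (hxm : x ∈ IsLocalRing.maximalIdeal R) {E : Type*} [AddCommGroup E] [Module R E]
    {q : K →ₗ[R] E} (hq : Function.Surjective q) (hqx : ∀ κ, q κ = 0 ↔ ∃ κ', x • κ' = κ) :
    IsInjectiveHullMod x E := by
  have : Module.Finite R K := hK.1
  have hreg := hK.smul_eq_zero hdim hx
  have hq0 (κ : K) : q (x • κ) = 0 := (hqx _).2 ⟨κ, rfl⟩
  have hxE (e : E) : x • e = 0 := by
    obtain ⟨κ, rfl⟩ := hq e
    rw [← map_smul, hq0]
  obtain ⟨hnt, P₀, P₁, _, _, _, _, ε, δ, _, _, hε, hex, h0, h1, h2⟩ := hK.exists_presentation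
  obtain ⟨s, hs⟩ := Module.projective_lifting_property (IsLocalRing.maximalIdeal R).mkQ ε
    (IsLocalRing.maximalIdeal R).mkQ_surjective
  have hsε (p : P₀) (hp : ε p = 0) : s p ∈ IsLocalRing.maximalIdeal R := by
    rwa [← hs, LinearMap.comp_apply, Submodule.mkQ_apply, Submodule.Quotient.mk_eq_zero] at hp
  obtain ⟨p₀, hp₀⟩ := hε ((IsLocalRing.maximalIdeal R).mkQ 1)
  have hu : IsUnit (s p₀) := by
    by_contra hnu
    have h3 : s p₀ ∈ IsLocalRing.maximalIdeal R := hnu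
    rw [← hs, LinearMap.comp_apply, Submodule.mkQ_apply, (Submodule.Quotient.mk_eq_zero _).2 h3,
      eq_comm, Submodule.mkQ_apply, Submodule.Quotient.mk_eq_zero] at hp₀
    exact (Ideal.ne_top_iff_one _).1 (IsLocalRing.maximalIdeal.isMaximal R).ne_top hp₀
  obtain ⟨u, hu⟩ := hu
  have hsmul (r : R) (hr : r ∈ IsLocalRing.maximalIdeal R) (p : P₀) : ε (r • p) = 0 := by
    rw [← hs, LinearMap.comp_apply, map_smul, Submodule.mkQ_apply,
      Submodule.Quotient.mk_eq_zero]
    exact Ideal.mul_mem_right _ _ hr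
  refine ⟨hxE, fun h hh => ?_, ?_, fun e₁ e₂ he₁ he₂ hne => ?_⟩
  · let δ' : P₁ →ₗ[R] LinearMap.ker ε := LinearMap.codRestrict _ δ fun y => (hex _).2 ⟨y, rfl⟩
    have hδ' : Function.Surjective δ' := by
      rintro ⟨z, hz⟩
      obtain ⟨y, hy⟩ := (hex z).1 hz
      exact ⟨y, Subtype.ext hy⟩
    have hk : LinearMap.ker δ' = LinearMap.ker δ := LinearMap.ker_codRestrict ..
    let s' : LinearMap.ker ε →ₗ[R] IsLocalRing.maximalIdeal R :=
      LinearMap.codRestrict _ (s ∘ₗ (LinearMap.ker ε).subtype) fun z => hsε z z.2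
    obtain ⟨h', hh'⟩ := exists_lift_of_forall_extends hδ' hreg hq hqx (by
      rw [hk]; exact h2) (h ∘ₗ s')
    obtain ⟨G, hG⟩ := exists_smul_eq_of_forall_exists hreg
      (h' ∘ₗ LinearMap.codRestrict (LinearMap.ker ε) (LinearMap.lsmul R P₀ x)
        fun p => hsmul x hxm p) fun p => (hqx _).1 (by
        rw [LinearMap.comp_apply, hh', LinearMap.comp_apply]
        have : s' (LinearMap.codRestrict (LinearMap.ker ε) (LinearMap.lsmul R P₀ x)
          (fun p => hsmul x hxm p) p) = s p • ⟨x, hxm⟩ := Subtype.ext (by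
            show s (x • p) = s p * x
            rw [map_smul, smul_eq_mul, mul_comm])
        rw [this, map_smul, hh _ rfl, smul_zero])
    have hG' (z : LinearMap.ker ε) : G z = h' z := by
      refine sub_eq_zero.1 (hreg _ ?_)
      rw [smul_sub, hG, ← map_smul, sub_eq_zero]
      rfl
    refine ⟨(↑u⁻¹ : R) • q (G p₀), fun r => ?_⟩
    have h3 := hh' ⟨r.1 • p₀, hsmul r r.2 p₀⟩
    rw [← hG', LinearMap.comp_apply] at h3
    have h4 : s' ⟨r.1 • p₀, hsmul r r.2 p₀⟩ = (u : R) • r := Subtype.ext (by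
      show s (r.1 • p₀) = (u : R) * r
      rw [map_smul, hu, smul_eq_mul, mul_comm])
    rw [h4, map_smul, map_smul, map_smul] at h3
    rw [smul_comm, h3, smul_smul, Units.inv_mul, one_smul]
  · have hE : (⊥ : Submodule R E) ≠ ⊤ := fun hbt => by
      have hbt' : (⊥ : Submodule R K) = ⊤ :=
        Submodule.eq_top_of_forall_exists_add_smul hxm _ fun κ => by
          have : q κ ∈ (⊥ : Submodule R E) := hbt ▸ trivial
          obtain ⟨κ', rfl⟩ := (hqx κ).1 ((Submodule.mem_bot R).1 this)
          exact ⟨0, Submodule.zero_mem _, κ', (zero_add _).symm⟩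
      exact bot_ne_top hbt'
    obtain ⟨z, hz, hmz⟩ := exists_notMem_forall_smul_mem hdim hx hE
      fun y => (Submodule.mem_bot R).2 (hxE y)
    exact ⟨z, fun h => hz ((Submodule.mem_bot R).2 h),
      fun r hr => (Submodule.mem_bot R).1 (hmz r hr)⟩
  · have lift (e : E) (he : ∀ r ∈ IsLocalRing.maximalIdeal R, r • e = 0) :
        ∃ (H : P₀ →ₗ[R] K) (g : P₁ →ₗ[R] K), (∀ p, q (H p) = s p • e) ∧
          ∀ y, x • g y = H (δ y) := by
      obtain ⟨H, hH⟩ := Module.projective_lifting_property q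
        (LinearMap.toSpanSingleton R E e ∘ₗ s) hq
      have hH' (p) : q (H p) = s p • e := LinearMap.congr_fun hH p
      obtain ⟨g, hg⟩ := exists_smul_eq_of_forall_exists hreg (H ∘ₗ δ) fun y => (hqx _).1 (by
        rw [LinearMap.comp_apply, hH', he _ (hsε _ ((hex _).2 ⟨y, rfl⟩))])
      exact ⟨H, g, hH', hg⟩
    obtain ⟨H₁, g₁, hH₁, hg₁⟩ := lift e₁ he₁
    obtain ⟨H₂, g₂, hH₂, hg₂⟩ := lift e₂ he₂
    have cancel {a b : E} (hab : s p₀ • a = s p₀ • b) : a = b := by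
      rw [← hu] at hab
      have := congrArg (fun c => (↑u⁻¹ : R) • c) hab
      simpa only [smul_smul, Units.inv_mul, one_smul] using this
    rcases h1 g₁ g₂
      (fun z hz => hreg _ (by rw [hg₁, hz, map_zero]))
      (fun z hz => hreg _ (by rw [hg₂, hz, map_zero])) with ⟨G, hG⟩ | ⟨r, G, hG⟩
    · exfalso
      have h3 := LinearMap.congr_fun (h0 (H₁ - x • G) (LinearMap.ext fun y => by
        have h4 : G (δ y) = g₁ y := LinearMap.congr_fun hG y
        rw [LinearMap.comp_apply, LinearMap.sub_apply, LinearMap.smul_apply, h4, hg₁, sub_self,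
          LinearMap.zero_apply])) p₀
      have h5 := congrArg q h3
      rw [LinearMap.sub_apply, LinearMap.smul_apply, map_sub, hq0, hH₁, sub_zero,
        LinearMap.zero_apply, map_zero] at h5
      exact hne (cancel (by rw [h5, smul_zero]))
    · refine ⟨r, cancel ?_⟩
      have h3 := LinearMap.congr_fun (h0 (H₂ - r • H₁ - x • G) (LinearMap.ext fun y => by
        have h4 : G (δ y) = g₂ y - r • g₁ y := LinearMap.congr_fun hG y
        rw [LinearMap.comp_apply, LinearMap.sub_apply, LinearMap.sub_apply, LinearMap.smul_apply,
          LinearMap.smul_apply, h4, smul_sub, smul_comm, hg₁, hg₂, sub_self,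
          LinearMap.zero_apply])) p₀
      have h5 := congrArg q h3
      rw [LinearMap.sub_apply, LinearMap.sub_apply, LinearMap.smul_apply, LinearMap.smul_apply,
        map_sub, map_sub, map_smul, hq0, hH₁, hH₂, sub_zero, LinearMap.zero_apply, map_zero,
        sub_eq_zero] at h5
      rw [h5, smul_comm]

end IsCanonicalModuleAt

namespace IsCanonicalModuleAt

variable {R : Type u} [CommRing R] [IsLocalRing R] [IsNoetherianRing R] {K : Type u}
  [AddCommGroup K] [Module R K] {x : R}

/-- Maps into a canonical module extend from the kernel of a surjection of a projective module
onto a module on which `x` is regular. -/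
theorem exists_extension_of_ker (hK : IsCanonicalModuleAt R (IsLocalRing.maximalIdeal R) K)
    (hdim : ringKrullDim R ≤ 1) (hx : x ∈ nonZeroDivisors R)
    (hxm : x ∈ IsLocalRing.maximalIdeal R) {P M : Type*} [AddCommGroup P] [Module R P]
    [Module.Finite R P] [Module.Projective R P] [AddCommGroup M] [Module R M]
    (hM : ∀ y : M, x • y = 0 → y = 0) (p : P →ₗ[R] M) (g : LinearMap.ker p →ₗ[R] K) :
    ∃ G : P →ₗ[R] K, ∀ z : LinearMap.ker p, G z = g z := by
  have : Module.Finite R K := hK.1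
  have hreg := hK.smul_eq_zero hdim hx
  let q := (LinearMap.range (LinearMap.lsmul R K x)).mkQ
  have hq : Function.Surjective q := Submodule.mkQ_surjective _
  have hqx (κ : K) : q κ = 0 ↔ ∃ κ', x • κ' = κ := Submodule.Quotient.mk_eq_zero _
  have hE := hK.isInjectiveHullMod hdim hx hxm hq hqx
  let res : (P →ₗ[R] K) →ₗ[R] (LinearMap.ker p →ₗ[R] K) :=
    LinearMap.lcomp R K (LinearMap.ker p).subtype
  have htop : LinearMap.range res = ⊤ :=
    Submodule.eq_top_of_forall_exists_add_smul hxm _ fun g => by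
      obtain ⟨H, hH⟩ := hE.exists_extension hdim hx (LinearMap.ker p) (q ∘ₗ g) fun n y hn => by
        have hy : p y = 0 := hM _ (by rw [← map_smul, ← hn, n.2])
        have : n = x • (⟨y, hy⟩ : LinearMap.ker p) := Subtype.ext hn
        rw [LinearMap.comp_apply, this, map_smul]
        exact (hqx _).2 ⟨_, rfl⟩
      obtain ⟨G, hG⟩ := Module.projective_lifting_property q H hq
      obtain ⟨g', hg'⟩ := exists_smul_eq_of_forall_exists hreg (g - res G) fun n => (hqx _).1 (by
        have h1 : q (G n) = q (g n) := (LinearMap.congr_fun hG n).trans (hH n)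
        rw [LinearMap.sub_apply, map_sub, sub_eq_zero]
        exact h1.symm)
      refine ⟨res G, ⟨G, rfl⟩, g', LinearMap.ext fun n => ?_⟩
      rw [LinearMap.add_apply, LinearMap.smul_apply, hg', LinearMap.sub_apply, add_sub_cancel]
  obtain ⟨G, hG⟩ : g ∈ LinearMap.range res := htop ▸ trivial
  exact ⟨G, fun z => LinearMap.congr_fun hG z⟩

section

variable {M : Type*} [AddCommGroup M] [Module R M] [Module.Finite R M]

/-- Maps from a module on which `x` is regular lift along `K → K/xK`. -/
theorem exists_lift (hK : IsCanonicalModuleAt R (IsLocalRing.maximalIdeal R) K)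
    (hdim : ringKrullDim R ≤ 1) (hx : x ∈ nonZeroDivisors R)
    (hxm : x ∈ IsLocalRing.maximalIdeal R) (hM : ∀ y : M, x • y = 0 → y = 0)
    {E : Type*} [AddCommGroup E] [Module R E] {q : K →ₗ[R] E} (hq : Function.Surjective q)
    (hqx : ∀ κ, q κ = 0 ↔ ∃ κ', x • κ' = κ) (h : M →ₗ[R] E) :
    ∃ h' : M →ₗ[R] K, ∀ y, q (h' y) = h y := by
  obtain ⟨n, p, hp⟩ := Module.Finite.exists_fin' R M
  exact exists_lift_of_forall_extends hp (hK.smul_eq_zero hdim hx) hq hqx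
    (hK.exists_extension_of_ker hdim hx hxm hM p) h

/-- The canonical dual separates points. -/
theorem eq_zero_of_forall_apply_eq_zero
    (hK : IsCanonicalModuleAt R (IsLocalRing.maximalIdeal R) K)
    (hdim : ringKrullDim R ≤ 1) (hx : x ∈ nonZeroDivisors R)
    (hxm : x ∈ IsLocalRing.maximalIdeal R) (hM : ∀ y : M, x • y = 0 → y = 0)
    (y : M) (hy : ∀ f : M →ₗ[R] K, f y = 0) : y = 0 := by
  have hreg := hK.smul_eq_zero hdim hx
  let q := (LinearMap.range (LinearMap.lsmul R K x)).mkQ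
  have hq : Function.Surjective q := Submodule.mkQ_surjective _
  have hqx (κ : K) : q κ = 0 ↔ ∃ κ', x • κ' = κ := Submodule.Quotient.mk_eq_zero _
  have hE := hK.isInjectiveHullMod hdim hx hxm hq hqx
  let T : Submodule R M := LinearMap.ker (LinearMap.applyₗ : M →ₗ[R] (M →ₗ[R] K) →ₗ[R] K)
  have hT (z : M) : z ∈ T ↔ ∀ f : M →ₗ[R] K, f z = 0 := LinearMap.ext_iff
  have htop : (⊥ : Submodule R T) = ⊤ :=
    Submodule.eq_top_of_forall_exists_add_smul hxm _ fun z => by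
      have hz := (hT z).1 z.2
      have : ∃ y : M, (z : M) = x • y := by
        by_contra! hc
        obtain ⟨h, hh⟩ := hE.exists_apply_ne_zero hdim hx (z : M) hc
        obtain ⟨h', hh'⟩ := hK.exists_lift hdim hx hxm hM hq hqx h
        rw [← hh', hz, map_zero] at hh
        exact hh rfl
      obtain ⟨w, hw⟩ := this
      have hwT : w ∈ T := (hT w).2 fun f => hreg _ (by rw [← map_smul, ← hw, hz])
      exact ⟨0, Submodule.zero_mem _, ⟨w, hwT⟩, by rw [zero_add]; exact Subtype.ext hw⟩
  have : (⟨y, (hT y).2 hy⟩ : T) ∈ (⊥ : Submodule R T) := htop ▸ trivial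
  exact congrArg Subtype.val ((Submodule.mem_bot R).1 this)

/-- Every functional on the canonical dual is an evaluation. -/
theorem exists_eq_apply (hK : IsCanonicalModuleAt R (IsLocalRing.maximalIdeal R) K)
    (hdim : ringKrullDim R ≤ 1) (hx : x ∈ nonZeroDivisors R)
    (hxm : x ∈ IsLocalRing.maximalIdeal R) (hM : ∀ y : M, x • y = 0 → y = 0)
    (φ : (M →ₗ[R] K) →ₗ[R] K) : ∃ c : M, ∀ f, φ f = f c := by
  have : Module.Finite R K := hK.1
  have hreg := hK.smul_eq_zero hdim hx
  let q := (LinearMap.range (LinearMap.lsmul R K x)).mkQ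
  have hq : Function.Surjective q := Submodule.mkQ_surjective _
  have hqx (κ : K) : q κ = 0 ↔ ∃ κ', x • κ' = κ := Submodule.Quotient.mk_eq_zero _
  have hE := hK.isInjectiveHullMod hdim hx hxm hq hqx
  let qs : (M →ₗ[R] K) →ₗ[R] (M →ₗ[R] (K ⧸ LinearMap.range (LinearMap.lsmul R K x))) :=
    LinearMap.llcomp R M K _ q
  have hqs : Function.Surjective qs := fun h => by
    obtain ⟨h', hh'⟩ := hK.exists_lift hdim hx hxm hM hq hqx h
    exact ⟨h', LinearMap.ext hh'⟩
  let ev : M →ₗ[R] (M →ₗ[R] K) →ₗ[R] K := LinearMap.applyₗ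
  have htop : LinearMap.range ev = ⊤ :=
    Submodule.eq_top_of_forall_exists_add_smul hxm _ fun φ => by
      obtain ⟨ψ, hψ⟩ := exists_linearMap_of_ker_le hqs (q ∘ₗ φ) fun f hf => by
        obtain ⟨f', hf'⟩ := exists_smul_eq_of_forall_exists hreg f fun n =>
          (hqx _).1 (LinearMap.congr_fun hf n)
        have : f = x • f' := LinearMap.ext fun n => (hf' n).symm
        rw [LinearMap.comp_apply, this, map_smul]
        exact (hqx _).2 ⟨_, rfl⟩
      obtain ⟨c, hc⟩ := hE.exists_eq_apply hdim hx ψ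
      obtain ⟨φ', hφ'⟩ := exists_smul_eq_of_forall_exists hreg (φ - ev c) fun f => (hqx _).1 (by
        have h1 : q (φ f) = q (f c) := (hψ f).symm.trans (hc _)
        rw [LinearMap.sub_apply, map_sub, sub_eq_zero]
        exact h1)
      refine ⟨ev c, ⟨c, rfl⟩, φ', LinearMap.ext fun f => ?_⟩
      rw [LinearMap.add_apply, LinearMap.smul_apply, hφ', LinearMap.sub_apply, add_sub_cancel]
  obtain ⟨c, hc⟩ : φ ∈ LinearMap.range ev := htop ▸ trivial
  exact ⟨c, fun f => (LinearMap.congr_fun hc f).symm⟩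

/-- A submodule `J` of full rank is everything once all functionals on `J` extend. -/
theorem eq_top_of_forall_extends (hK : IsCanonicalModuleAt R (IsLocalRing.maximalIdeal R) K)
    (hdim : ringKrullDim R ≤ 1) (hx : x ∈ nonZeroDivisors R)
    (hxm : x ∈ IsLocalRing.maximalIdeal R) (hM : ∀ y : M, x • y = 0 → y = 0)
    (J : Submodule R M) (hJ : ∀ y : M, ∃ d ∈ nonZeroDivisors R, d • y ∈ J)
    (hext : ∀ g : J →ₗ[R] K, ∃ G : M →ₗ[R] K, ∀ n : J, G n = g n) : J = ⊤ := by
  have hreg := hK.smul_eq_zero hdim hx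
  let q := (LinearMap.range (LinearMap.lsmul R K x)).mkQ
  have hq : Function.Surjective q := Submodule.mkQ_surjective _
  have hqx (κ : K) : q κ = 0 ↔ ∃ κ', x • κ' = κ := Submodule.Quotient.mk_eq_zero _
  have hE := hK.isInjectiveHullMod hdim hx hxm hq hqx
  have key : (⊥ : Submodule R (M ⧸ J)) = ⊤ :=
    Submodule.eq_top_of_forall_exists_add_smul hxm _ fun c => by
      suffices h : ∃ y, c = x • y by
        obtain ⟨y, hy⟩ := h
        exact ⟨0, Submodule.zero_mem _, y, by rw [zero_add, hy]⟩
      by_contra! hc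
      obtain ⟨h, hh⟩ := hE.exists_apply_ne_zero hdim hx c hc
      refine hh ?_
      obtain ⟨h', hh'⟩ := hK.exists_lift hdim hx hxm hM hq hqx (h ∘ₗ J.mkQ)
      obtain ⟨g, hg⟩ := exists_smul_eq_of_forall_exists hreg (h' ∘ₗ J.subtype) fun n =>
        (hqx _).1 (by
          rw [LinearMap.comp_apply, hh', LinearMap.comp_apply, Submodule.mkQ_apply,
            Submodule.subtype_apply, (Submodule.Quotient.mk_eq_zero J).2 n.2, map_zero])
      obtain ⟨G, hG⟩ := hext g
      obtain ⟨y, rfl⟩ := J.mkQ_surjective c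
      obtain ⟨d, hd, hdy⟩ := hJ y
      have h1 : h' y = x • G y := by
        refine sub_eq_zero.1 (hK.smul_eq_zero hdim hd _ ?_)
        have h2 := hG ⟨d • y, hdy⟩
        have h3 := hg ⟨d • y, hdy⟩
        rw [← h2] at h3
        rw [smul_sub, smul_comm, ← map_smul, ← map_smul, sub_eq_zero]
        exact h3.symm
      have h4 : h (J.mkQ y) = q (h' y) := (hh' y).symm
      rw [h4, h1]
      exact (hqx _).2 ⟨_, rfl⟩
  rw [eq_top_iff]
  intro y _
  have : J.mkQ y ∈ (⊥ : Submodule R (M ⧸ J)) := key ▸ trivial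
  rwa [Submodule.mem_bot, Submodule.mkQ_apply, Submodule.Quotient.mk_eq_zero] at this

end

end IsCanonicalModuleAt

section FractionalIdeal

variable {R : Type*} [CommRing R]

theorem FractionRing.exists_smul_eq_algebraMap (z : FractionRing R) :
    ∃ d ∈ nonZeroDivisors R, ∃ a : R, d • z = algebraMap R (FractionRing R) a := by
  obtain ⟨⟨a, d⟩, h⟩ := IsLocalization.surj (nonZeroDivisors R) z
  exact ⟨d, d.2, a, by rw [Algebra.smul_def, mul_comm]; exact h⟩

theorem FractionRing.eq_zero_of_smul_eq_zero {d : R} (hd : d ∈ nonZeroDivisors R)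
    {z : FractionRing R} (h : d • z = 0) : z = 0 := by
  rw [Algebra.smul_def] at h
  have := IsLocalization.map_units (FractionRing R) (⟨d, hd⟩ : nonZeroDivisors R)
  exact this.mul_right_eq_zero.1 h

theorem Submodule.eq_zero_of_torsion_eq_bot {M : Type*} [AddCommMonoid M] [Module R M]
    (h : Submodule.torsion R M = ⊥) {d : R} (hd : d ∈ nonZeroDivisors R) {t : M}
    (ht : d • t = 0) : t = 0 := by
  have : t ∈ Submodule.torsion R M := (Submodule.mem_torsion_iff t).2 ⟨⟨d, hd⟩, ht⟩
  rwa [h, Submodule.mem_bot] at this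

/-- Any two elements of a submodule of the total ring of fractions, the first one being a unit,
are proportional. -/
theorem FractionRing.exists_smul_eq_smul (I : Submodule R (FractionRing R)) {u : I}
    (hu : IsUnit (u : FractionRing R)) (y : I) :
    ∃ d ∈ nonZeroDivisors R, ∃ a : R, d • y = a • u := by
  obtain ⟨v, hv⟩ := hu
  obtain ⟨d, hd, a, h⟩ := FractionRing.exists_smul_eq_algebraMap
    ((y : FractionRing R) * (↑v⁻¹ : FractionRing R))
  refine ⟨d, hd, a, Subtype.ext ?_⟩
  show d • (y : FractionRing R) = a • (u : FractionRing R)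
  rw [Algebra.smul_def a, ← h, ← hv, smul_mul_assoc, mul_assoc, Units.inv_mul, mul_one]

/-- Multiplication by an element of a subalgebra stabilizing `I`. -/
def stabMul {A : Type*} [CommRing A] [Algebra R A] (S : Subalgebra R A) (I : Submodule R A)
    (h : ∀ s ∈ S, ∀ y ∈ I, s * y ∈ I) (s : S) : I →ₗ[R] I :=
  LinearMap.codRestrict I ((LinearMap.mulLeft R (s : A)).comp I.subtype)
    fun y => h s s.2 y y.2

/-- The map `S → I`, `s ↦ s x`, for `x ∈ I`. -/
def stabOrbit {A : Type*} [CommRing A] [Algebra R A] (S : Subalgebra R A) (I : Submodule R A)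
    (h : ∀ s ∈ S, ∀ y ∈ I, s * y ∈ I) (x : I) : S →ₗ[R] I :=
  LinearMap.codRestrict I ((LinearMap.mulRight R (x : A)).comp S.val.toLinearMap)
    fun s => h s s.2 (x : A) x.2

section

variable {A : Type*} [CommRing A] [Algebra R A] (S : Subalgebra R A) (I : Submodule R A)
  (h : ∀ s ∈ S, ∀ y ∈ I, s * y ∈ I)

/-- The identity map from `I` to `I` viewed as an `S`-module. -/
def toRestrictUp : I →+ restrictUp S I h where
  toFun x := ⟨x, x.2⟩
  map_zero' := rfl
  map_add' _ _ := rfl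

/-- The identity map from `I` viewed as an `S`-module to `I`. -/
def ofRestrictUp : restrictUp S I h →+ I where
  toFun x := ⟨x, x.2⟩
  map_zero' := rfl
  map_add' _ _ := rfl

theorem toRestrictUp_smul (r : R) (x : I) :
    toRestrictUp S I h (r • x) = algebraMap R S r • toRestrictUp S I h x := Subtype.ext (by
  show r • (x : A) = algebraMap R A r * x
  rw [Algebra.smul_def])

theorem ofRestrictUp_smul (s : S) (x : restrictUp S I h) :
    ofRestrictUp S I h (s • x) = stabMul S I h s (ofRestrictUp S I h x) := rfl

variable (K : Type*) [AddCommGroup K] [Module R K]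

theorem homToS_add (f g : I →ₗ[R] K) :
    homToS S I h K (f + g) = homToS S I h K f + homToS S I h K g := rfl

theorem homToS_smul (r : R) (f : I →ₗ[R] K) :
    homToS S I h K (r • f) = algebraMap R S r • homToS S I h K f := by
  refine LinearMap.ext fun x => LinearMap.ext fun s => ?_
  show r • f (stabOrbit S I h (ofRestrictUp S I h x) s) =
    f (stabOrbit S I h (ofRestrictUp S I h x) (algebraMap R S r * s))
  rw [← Algebra.smul_def, map_smul, map_smul]

/-- The inverse of `homToS`: evaluation at `1 ∈ S`. -/
def homOfS (ψ : ↥(restrictUp S I h) →ₗ[S] (↥S →ₗ[R] K)) : I →ₗ[R] K where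
  toFun x := ψ (toRestrictUp S I h x) 1
  map_add' x y := by rw [map_add, map_add, LinearMap.add_apply]
  map_smul' r x := by
    rw [toRestrictUp_smul, map_smul, canonicalHomSMul_apply, ← Algebra.smul_def, map_smul,
      RingHom.id_apply]

theorem homOfS_homToS (f : I →ₗ[R] K) : homOfS S I h K (homToS S I h K f) = f :=
  LinearMap.ext fun x => congrArg f (Subtype.ext (one_mul (x : A)))

theorem homToS_homOfS (ψ : ↥(restrictUp S I h) →ₗ[S] (↥S →ₗ[R] K)) :
    homToS S I h K (homOfS S I h K ψ) = ψ := by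
  refine LinearMap.ext fun x => LinearMap.ext fun s => ?_
  have : ψ (s • x) 1 = ψ x s := by rw [map_smul, canonicalHomSMul_apply, mul_one]
  exact this

theorem homOfS_smul (s : S) (ψ : ↥(restrictUp S I h) →ₗ[S] (↥S →ₗ[R] K)) :
    homOfS S I h K (s • ψ) = homOfS S I h K ψ ∘ₗ stabMul S I h s := by
  refine LinearMap.ext fun x => ?_
  show (s • ψ (toRestrictUp S I h x)) 1 = ψ (s • toRestrictUp S I h x) 1
  rw [map_smul]

/-- The canonical map `I ⊗_R Hom_R(I, K) → I ⊗_S Hom_S(I, K_S)`. -/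
def tensorHomToS : (↥I ⊗[R] (↥I →ₗ[R] K)) →+
    (↥(restrictUp S I h) ⊗[S] (↥(restrictUp S I h) →ₗ[S] (↥S →ₗ[R] K))) :=
  TensorProduct.liftAddHom
    (AddMonoidHom.mk' (fun x => AddMonoidHom.mk'
      (fun f => toRestrictUp S I h x ⊗ₜ[S] homToS S I h K f)
      fun f g => by rw [homToS_add, TensorProduct.tmul_add])
      fun x y => AddMonoidHom.ext fun f => by
        show toRestrictUp S I h (x + y) ⊗ₜ[S] homToS S I h K f = _ + _
        rw [map_add, TensorProduct.add_tmul]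
        rfl)
    fun r x f => by
      show toRestrictUp S I h (r • x) ⊗ₜ[S] homToS S I h K f =
        toRestrictUp S I h x ⊗ₜ[S] homToS S I h K (r • f)
      rw [toRestrictUp_smul, homToS_smul, TensorProduct.smul_tmul]

theorem tensorHomToS_tmul (x : I) (f : I →ₗ[R] K) :
    tensorHomToS S I h K (x ⊗ₜ[R] f) = toRestrictUp S I h x ⊗ₜ[S] homToS S I h K f := rfl

theorem tensorHomToS_smul (r : R) (t : ↥I ⊗[R] (↥I →ₗ[R] K)) :
    tensorHomToS S I h K (r • t) = algebraMap R S r • tensorHomToS S I h K t := by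
  induction t using TensorProduct.induction_on with
  | zero => rw [smul_zero, map_zero, smul_zero]
  | tmul x f =>
    rw [TensorProduct.smul_tmul', tensorHomToS_tmul, tensorHomToS_tmul, toRestrictUp_smul,
      TensorProduct.smul_tmul']
  | add a b ha hb => rw [smul_add, map_add, map_add, ha, hb, smul_add]

/-- The map `I ⊗_R Hom_R(I, K) → K_S`, `x ⊗ f ↦ (s ↦ f (s x))`. -/
def tensorEvalS : (↥I ⊗[R] (↥I →ₗ[R] K)) →ₗ[R] (↥S →ₗ[R] K) :=
  TensorProduct.lift (LinearMap.mk₂ R (fun x f => f ∘ₗ stabOrbit S I h x)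
    (fun x y f => LinearMap.ext fun s => by
      have : stabOrbit S I h (x + y) s = stabOrbit S I h x s + stabOrbit S I h y s :=
        Subtype.ext (mul_add (s : A) x y)
      rw [LinearMap.comp_apply, this, map_add]
      rfl)
    (fun r x f => LinearMap.ext fun s => by
      have : stabOrbit S I h (r • x) s = r • stabOrbit S I h x s :=
        Subtype.ext (mul_smul_comm r (s : A) (x : A))
      rw [LinearMap.comp_apply, this, map_smul]
      rfl)
    (fun x f g => rfl) fun r x f => rfl)

theorem tensorEvalS_tmul (x : I) (f : I →ₗ[R] K) :
    tensorEvalS S I h K (x ⊗ₜ[R] f) = f ∘ₗ stabOrbit S I h x := rfl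

theorem evalMap_tensorHomToS (t : ↥I ⊗[R] (↥I →ₗ[R] K)) :
    evalMap S (restrictUp S I h) (↥S →ₗ[R] K) (tensorHomToS S I h K t) =
      tensorEvalS S I h K t := by
  induction t using TensorProduct.induction_on with
  | zero => rw [map_zero, map_zero, map_zero]
  | tmul x f => rfl
  | add a b ha hb => rw [map_add, map_add, map_add, ha, hb]

end

variable {K : Type*} [AddCommGroup K] [Module R K]

/-- If `I ⊗ Hom(I, K)` is torsionfree, multiplications by elements stabilizing `I` can be moved
across the tensor product. -/
theorem stabMul_tmul (I : Submodule R (FractionRing R))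
    (htf : Submodule.torsion R (↥I ⊗[R] (↥I →ₗ[R] K)) = ⊥)
    (S : Subalgebra R (FractionRing R)) (hS : ∀ s ∈ S, ∀ y ∈ I, s * y ∈ I) (s : S) (x : I)
    (f : I →ₗ[R] K) :
    stabMul S I hS s x ⊗ₜ[R] f = x ⊗ₜ[R] (f ∘ₗ stabMul S I hS s) := by
  obtain ⟨d, hd, a, h⟩ := FractionRing.exists_smul_eq_algebraMap (s : FractionRing R)
  have hy (y : I) : d • stabMul S I hS s y = a • y := Subtype.ext (by
    show d • ((s : FractionRing R) * y) = a • (y : FractionRing R)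
    rw [← smul_mul_assoc, h, Algebra.smul_def])
  refine sub_eq_zero.1 (Submodule.eq_zero_of_torsion_eq_bot htf hd ?_)
  have hf : d • (f ∘ₗ stabMul S I hS s) = a • f := LinearMap.ext fun y => by
    rw [LinearMap.smul_apply, LinearMap.comp_apply, ← map_smul, hy, map_smul, LinearMap.smul_apply]
  rw [smul_sub, TensorProduct.smul_tmul', hy, ← TensorProduct.tmul_smul, hf,
    TensorProduct.smul_tmul, sub_self]

theorem tensorHomToS_bijective (I : Submodule R (FractionRing R))
    (htf : Submodule.torsion R (↥I ⊗[R] (↥I →ₗ[R] K)) = ⊥)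
    (S : Subalgebra R (FractionRing R)) (hS : ∀ s ∈ S, ∀ y ∈ I, s * y ∈ I) :
    Function.Bijective (tensorHomToS S I hS K) := by
  let σ : (↥(restrictUp S I hS) ⊗[S] (↥(restrictUp S I hS) →ₗ[S] (↥S →ₗ[R] K))) →+
      (↥I ⊗[R] (↥I →ₗ[R] K)) :=
    TensorProduct.liftAddHom
      (AddMonoidHom.mk' (fun x => AddMonoidHom.mk'
        (fun ψ => ofRestrictUp S I hS x ⊗ₜ[R] homOfS S I hS K ψ)
        fun f g => by rw [← TensorProduct.tmul_add]; rfl)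
        fun x y => AddMonoidHom.ext fun f => by
          show ofRestrictUp S I hS (x + y) ⊗ₜ[R] homOfS S I hS K f = _ + _
          rw [map_add, TensorProduct.add_tmul]
          rfl)
      fun s x ψ => by
        show ofRestrictUp S I hS (s • x) ⊗ₜ[R] homOfS S I hS K ψ =
          ofRestrictUp S I hS x ⊗ₜ[R] homOfS S I hS K (s • ψ)
        rw [homOfS_smul, ofRestrictUp_smul, stabMul_tmul I htf]
  have hσ (x ψ) : σ (x ⊗ₜ[S] ψ) = ofRestrictUp S I hS x ⊗ₜ[R] homOfS S I hS K ψ := rfl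
  refine Function.bijective_iff_has_inverse.2 ⟨σ, fun t => ?_, fun t => ?_⟩
  · induction t using TensorProduct.induction_on with
    | zero => rw [map_zero, map_zero]
    | tmul x f =>
      rw [tensorHomToS_tmul, hσ, homOfS_homToS]
      rfl
    | add a b ha hb => rw [map_add, map_add, ha, hb]
  · induction t using TensorProduct.induction_on with
    | zero => rw [map_zero, map_zero]
    | tmul x ψ =>
      rw [hσ, tensorHomToS_tmul, homToS_homOfS]
      rfl
    | add a b ha hb => rw [map_add, map_add, ha, hb]

theorem torsion_restrictUp_tensor_eq_bot (I : Submodule R (FractionRing R))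
    (htf : Submodule.torsion R (↥I ⊗[R] (↥I →ₗ[R] K)) = ⊥)
    (S : Subalgebra R (FractionRing R)) (hS : ∀ s ∈ S, ∀ y ∈ I, s * y ∈ I) :
    Submodule.torsion S
      (↥(restrictUp S I hS) ⊗[S] (↥(restrictUp S I hS) →ₗ[S] (↥S →ₗ[R] K))) = ⊥ := by
  rw [eq_bot_iff]
  intro t ht
  obtain ⟨⟨c, hc⟩, hct⟩ := (Submodule.mem_torsion_iff t).1 ht
  have hct : c • t = 0 := hct
  obtain ⟨t, rfl⟩ := (tensorHomToS_bijective I htf S hS).2 t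
  obtain ⟨b, hb, a, h⟩ := FractionRing.exists_smul_eq_algebraMap (c : FractionRing R)
  have hcb : algebraMap R S a = algebraMap R S b * c := Subtype.ext (by
    show algebraMap R (FractionRing R) a = algebraMap R (FractionRing R) b * c
    rw [← h, Algebra.smul_def])
  have hinj : Function.Injective (algebraMap R S) := fun r r' hr =>
    IsFractionRing.injective R (FractionRing R) (congrArg Subtype.val hr)
  have hbS (s : S) (hs : algebraMap R S b * s = 0) : s = 0 := Subtype.ext
    (FractionRing.eq_zero_of_smul_eq_zero hb (by
      rw [Algebra.smul_def]; exact congrArg Subtype.val hs))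
  have ha : a ∈ nonZeroDivisors R := mem_nonZeroDivisors_iff_right.2 fun r hr => hinj (by
    rw [map_zero]
    refine mem_nonZeroDivisors_iff_right.1 hc (algebraMap R S r) (hbS _ ?_)
    rw [mul_left_comm, ← hcb, ← map_mul, hr, map_zero])
  have h0 : a • t = 0 := (tensorHomToS_bijective I htf S hS).1 (by
    rw [tensorHomToS_smul, hcb, mul_smul, hct, smul_zero, map_zero])
  rw [Submodule.eq_zero_of_torsion_eq_bot htf ha h0, map_zero]
  exact Submodule.zero_mem _

theorem tensorEvalS_injective
    (hKt : ∀ d ∈ nonZeroDivisors R, ∀ κ : K, d • κ = 0 → κ = 0)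
    (I : Submodule R (FractionRing R)) (hI : ∃ x ∈ I, IsUnit x)
    (htf : Submodule.torsion R (↥I ⊗[R] (↥I →ₗ[R] K)) = ⊥)
    (S : Subalgebra R (FractionRing R)) (hS : ∀ s ∈ S, ∀ y ∈ I, s * y ∈ I) :
    Function.Injective (tensorEvalS S I hS K) := by
  obtain ⟨u, huI, hu⟩ := hI
  lift u to I using huI
  have key (t : ↥I ⊗[R] (↥I →ₗ[R] K)) :
      ∃ d ∈ nonZeroDivisors R, ∃ g : I →ₗ[R] K, d • t = u ⊗ₜ[R] g := by
    induction t using TensorProduct.induction_on with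
    | zero => exact ⟨1, one_mem _, 0, by rw [smul_zero, TensorProduct.tmul_zero]⟩
    | tmul x f =>
      obtain ⟨d, hd, a, h⟩ := FractionRing.exists_smul_eq_smul I hu x
      exact ⟨d, hd, a • f, by rw [TensorProduct.smul_tmul', h, TensorProduct.smul_tmul]⟩
    | add t₁ t₂ h₁ h₂ =>
      obtain ⟨d₁, hd₁, g₁, h₁⟩ := h₁
      obtain ⟨d₂, hd₂, g₂, h₂⟩ := h₂
      refine ⟨d₁ * d₂, mul_mem hd₁ hd₂, d₂ • g₁ + d₁ • g₂, ?_⟩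
      rw [smul_add, mul_smul, mul_smul, smul_comm, h₁, h₂, TensorProduct.tmul_add,
        TensorProduct.tmul_smul, TensorProduct.tmul_smul]
  refine (injective_iff_map_eq_zero _).2 fun t ht => ?_
  obtain ⟨d, hd, g, hg⟩ := key t
  have h0 : tensorEvalS S I hS K (u ⊗ₜ[R] g) = 0 := by rw [← hg, map_smul, ht, smul_zero]
  have hgu : g u = 0 := by
    have := LinearMap.congr_fun h0 1
    rw [tensorEvalS_tmul, LinearMap.comp_apply, LinearMap.zero_apply] at this
    rwa [show stabOrbit S I hS u 1 = u from Subtype.ext (one_mul (u : FractionRing R))] at this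
  have hg0 : g = 0 := LinearMap.ext fun y => by
    obtain ⟨d, hd, a, h⟩ := FractionRing.exists_smul_eq_smul I hu y
    refine hKt d hd _ ?_
    rw [← map_smul, h, map_smul, hgu, smul_zero]
  refine Submodule.eq_zero_of_torsion_eq_bot htf hd ?_
  rw [hg, hg0, TensorProduct.tmul_zero]

/-- A finitely generated submodule of the total ring of fractions has a common denominator. -/
theorem FractionRing.exists_forall_smul_mem_range {I : Submodule R (FractionRing R)} (hI : I.FG)
    (v : FractionRing R) : ∃ d ∈ nonZeroDivisors R, ∀ y ∈ I, ∃ a : R,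
      d • (v * y) = algebraMap R (FractionRing R) a := by
  classical
  obtain ⟨s, rfl⟩ := hI
  obtain ⟨d, hd⟩ := IsLocalization.exist_integer_multiples_of_finset (nonZeroDivisors R)
    (s.image (v * ·))
  refine ⟨d, d.2, fun y hy => ?_⟩
  induction hy using Submodule.span_induction with
  | mem y hy =>
    obtain ⟨a, ha⟩ := hd _ (Finset.mem_image_of_mem _ hy)
    exact ⟨a, ha.symm⟩
  | zero => exact ⟨0, by rw [mul_zero, smul_zero, map_zero]⟩
  | add y z _ _ hy hz =>
    obtain ⟨a, ha⟩ := hy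
    obtain ⟨b, hb⟩ := hz
    exact ⟨a + b, by rw [mul_add, smul_add, ha, hb, map_add]⟩
  | smul r y _ hy =>
    obtain ⟨a, ha⟩ := hy
    exact ⟨r * a, by rw [mul_smul_comm, smul_comm, ha, map_mul, Algebra.smul_def]⟩

end FractionalIdeal

theorem mul_mem_of_mem_colonAlg {R A : Type*} [CommRing R] [CommRing A] [Algebra R A]
    (I : Submodule R A) : ∀ s ∈ colonAlg I, ∀ y ∈ I, s * y ∈ I := fun _ hs => hs

theorem tensorEvalS_surjective {R : Type u} [CommRing R] [IsLocalRing R]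
    (hCM : IsOneDimCMLocal R) {K : Type u} [AddCommGroup K] [Module R K]
    (hK : IsCanonicalModuleAt R (IsLocalRing.maximalIdeal R) K)
    (I : Submodule R (FractionRing R)) (hI : IsFracIdealUnit R I) :
    Function.Surjective (tensorEvalS (colonAlg I) I (mul_mem_of_mem_colonAlg I) K) := by
  obtain ⟨hnoeth, hdim, x, hxm, hx⟩ := hCM
  have hdim : ringKrullDim R ≤ 1 := hdim.le
  obtain ⟨hFG, u, huI, hu⟩ := hI
  lift u to I using huI
  have : Module.Finite R K := hK.1
  have : Module.Finite R I := Module.Finite.iff_fg.2 hFG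
  have hIx (d : R) (hd : d ∈ nonZeroDivisors R) (y : I) (hy : d • y = 0) : y = 0 :=
    Subtype.ext (FractionRing.eq_zero_of_smul_eq_zero hd (congrArg Subtype.val hy))
  have hB : Module.Finite R (colonAlg I) :=
    Module.Finite.of_injective (stabOrbit (colonAlg I) I (mul_mem_of_mem_colonAlg I) u)
      fun a b hab => Subtype.ext (hu.mul_left_injective (congrArg Subtype.val hab))
  obtain ⟨v, hv⟩ := hu
  rw [← LinearMap.range_eq_top]
  refine hK.eq_top_of_forall_extends hdim hx hxm
    (fun w hw => LinearMap.ext fun b => hK.smul_eq_zero hdim hx _ (LinearMap.congr_fun hw b)) _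
    (fun w => ?_) fun g => ?_
  · obtain ⟨d, hd, h⟩ := FractionRing.exists_forall_smul_mem_range hFG
      ((↑v⁻¹ : FractionRing R))
    let m : I →ₗ[R] colonAlg I := LinearMap.codRestrict (Subalgebra.toSubmodule (colonAlg I))
      ((d • LinearMap.mulLeft R (↑v⁻¹ : FractionRing R)).comp I.subtype) fun y => by
        obtain ⟨a, ha⟩ := h y y.2
        show d • ((↑v⁻¹ : FractionRing R) * y) ∈ colonAlg I
        rw [ha]
        exact (colonAlg I).algebraMap_mem a
    refine ⟨d, hd, u ⊗ₜ[R] (w ∘ₗ m), LinearMap.ext fun b => ?_⟩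
    have hb : m (stabOrbit (colonAlg I) I (mul_mem_of_mem_colonAlg I) u b) = d • b :=
      Subtype.ext (by
      show d • ((↑v⁻¹ : FractionRing R) * ((b : FractionRing R) * u)) = d • (b : FractionRing R)
      rw [← hv, mul_comm (b : FractionRing R), ← mul_assoc, Units.inv_mul, one_mul])
    rw [tensorEvalS_tmul, LinearMap.comp_apply, LinearMap.comp_apply, hb, map_smul,
      LinearMap.smul_apply]
  · let j := (tensorEvalS (colonAlg I) I (mul_mem_of_mem_colonAlg I) K).rangeRestrict
    have hθ (y : I) : ∃ c : I, ∀ f : I →ₗ[R] K, g (j (y ⊗ₜ[R] f)) = f c :=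
      hK.exists_eq_apply hdim hx hxm (hIx x hx) (g ∘ₗ j ∘ₗ TensorProduct.mk R I (I →ₗ[R] K) y)
    choose θ hθ using hθ
    have hprop (d a : R) (y : I) (hy : d • y = a • u) : d • θ y = a • θ u := by
      refine sub_eq_zero.1 (hK.eq_zero_of_forall_apply_eq_zero hdim hx hxm (hIx x hx) _
        fun f => ?_)
      rw [map_sub, map_smul, map_smul, ← hθ, ← hθ, ← map_smul, ← map_smul, ← map_smul, ← map_smul,
        TensorProduct.smul_tmul', TensorProduct.smul_tmul', hy, sub_self]
    have hβ (y : I) : (θ u : FractionRing R) * ↑v⁻¹ * y = θ y := by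
      obtain ⟨d, hd, a, h⟩ := FractionRing.exists_smul_eq_smul I ⟨v, hv⟩ y
      refine sub_eq_zero.1 (FractionRing.eq_zero_of_smul_eq_zero hd ?_)
      have h1 : d • (y : FractionRing R) = a • (u : FractionRing R) := congrArg Subtype.val h
      have h2 : d • (θ y : FractionRing R) = a • (θ u : FractionRing R) :=
        congrArg Subtype.val (hprop d a y h)
      rw [smul_sub, h2, ← mul_smul_comm, h1, mul_smul_comm, ← hv, mul_assoc, Units.inv_mul,
        mul_one, sub_self]
    let β : colonAlg I := ⟨(θ u : FractionRing R) * ↑v⁻¹, fun y hy => by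
      rw [hβ ⟨y, hy⟩]
      exact (θ ⟨y, hy⟩).2⟩
    refine ⟨LinearMap.applyₗ β, ?_⟩
    have hcomp : (LinearMap.applyₗ β : (colonAlg I →ₗ[R] K) →ₗ[R] K) ∘ₗ
        tensorEvalS (colonAlg I) I (mul_mem_of_mem_colonAlg I) K = g ∘ₗ j :=
      TensorProduct.ext' fun y f => by
        rw [LinearMap.comp_apply, LinearMap.comp_apply, hθ]
        exact congrArg f (Subtype.ext (hβ y))
    rintro ⟨-, t, rfl⟩
    exact LinearMap.congr_fun hcomp t

/-- (Lemma 2.1a) Let `R` be a one-dimensional Cohen–Macaulay local ring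
with canonical module `K`, and `I` a fractional ideal with `FI = F` such that
`I ⊗_R Hom_R(I, K)` is torsionfree. Let `R ⊆ S ⊆ B = I : I` be an intermediate ring.
Then `I ⊗_S Hom_S(I, K_S)` is a torsionfree `S`-module, the canonical map
`ρ : I ⊗_R Hom_R(I, K) → I ⊗_S Hom_S(I, K_S)` is bijective, and, taking `S = B`, the
evaluation map `t_B : I ⊗_B Hom_B(I, K_B) → K_B` is an isomorphism. -/
theorem stmt1 (R : Type u) [CommRing R] [IsLocalRing R]
    (hCM : IsOneDimCMLocal R)
    (K : Type u) [AddCommGroup K] [Module R K]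
    (hK : IsCanonicalModuleAt R (IsLocalRing.maximalIdeal R) K)
    (I : Submodule R (FractionRing R)) (hI : IsFracIdealUnit R I)
    (htf : Submodule.torsion R (↥I ⊗[R] (↥I →ₗ[R] K)) = ⊥)
    (S : Subalgebra R (FractionRing R)) (hS : ∀ s ∈ S, ∀ y ∈ I, s * y ∈ I) :
    Submodule.torsion S
        (↥(restrictUp S I hS) ⊗[S]
          (↥(restrictUp S I hS) →ₗ[S] (↥S →ₗ[R] K))) = ⊥ ∧
    (∃ ρ : (↥I ⊗[R] (↥I →ₗ[R] K)) →+
        (↥(restrictUp S I hS) ⊗[S] (↥(restrictUp S I hS) →ₗ[S] (↥S →ₗ[R] K))),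
      (∀ (x : ↥I) (f : ↥I →ₗ[R] K),
        ρ (x ⊗ₜ[R] f) =
          (⟨(x : FractionRing R), x.2⟩ : ↥(restrictUp S I hS)) ⊗ₜ[S]
            homToS S I hS K f) ∧
      Function.Bijective ρ) ∧
    Function.Bijective
      (evalMap ↥(colonAlg I)
        (restrictUp (colonAlg I) I (fun s hs => hs))
        (↥(colonAlg I) →ₗ[R] K)) := by
  refine ⟨torsion_restrictUp_tensor_eq_bot I htf S hS, ⟨tensorHomToS S I hS K, fun x f => rfl,
    tensorHomToS_bijective I htf S hS⟩, ?_⟩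
  have hdim : ringKrullDim R ≤ 1 := hCM.2.1.le
  have : IsNoetherianRing R := hCM.1
  have hρ := tensorHomToS_bijective I htf (colonAlg I) (mul_mem_of_mem_colonAlg I)
  have hj : Function.Bijective (tensorEvalS (colonAlg I) I (mul_mem_of_mem_colonAlg I) K) :=
    ⟨tensorEvalS_injective (fun d hd κ => hK.smul_eq_zero hdim hd κ) I hI.2 htf _ _,
      tensorEvalS_surjective hCM hK I hI⟩
  refine (Function.Bijective.of_comp_iff _ hρ).1 ?_
  convert hj using 1
  exact funext fun t => evalMap_tensorHomToS _ _ _ _ t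

end
end

section
/- Let R be a one-dimensional Cohen–Macaulay local ring with maximal ideal m possessing a canonical module K_R. Let I be an m-primary ideal of R and assume I² = aI for some a ∈ I. If I ⊗_R Hom_R(I, K_R) is torsionfree, then I = aR. -/
open CategoryTheory TensorProduct

noncomputable section

/-- If `Ext^n(X, K)` is nontrivial for some `n`, then so is `K`. -/
theorem nontrivial_of_nontrivial_extMod {R : Type u} [CommRing R] {X K : ModuleCat.{u} R} {n : ℕ}
    (h : Nontrivial (extMod R X K n)) : Nontrivial K := by
  by_contra hK
  rw [not_nontrivial_iff_subsingleton] at hK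
  refine not_subsingleton (extMod R X K n) (ModuleCat.subsingleton_of_isZero ?_)
  refine Limits.IsZero.of_iso ?_ ((projectiveResolution X).isoExt (R := R) n K)
  rw [← HomologicalComplex.exactAt_iff_isZero_homology, HomologicalComplex.exactAt_iff]
  refine ShortComplex.exact_of_isZero_X₂ _ ?_
  rw [Limits.IsZero.iff_id_eq_zero]
  ext (x : _ ⟶ _)
  obtain rfl : x = 0 := (ModuleCat.isZero_of_subsingleton K).eq_of_tgt _ _
  rfl

/-- If `Ext^0(X, K) = 0`, then every morphism `X ⟶ K` vanishes. -/
theorem hom_eq_zero_of_subsingleton_extMod_zero {R : Type u} [CommRing R] {X K : ModuleCat.{u} R}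
    (h : Subsingleton (extMod R X K 0)) (f : X ⟶ K) : f = 0 := by
  let P := projectiveResolution X
  obtain ⟨ε, hε, hdε⟩ : ∃ ε : P.complex.X 0 ⟶ X, Epi ε ∧ P.complex.d 1 0 ≫ ε = 0 :=
    ⟨P.π.f 0, inferInstanceAs (Epi (P.π.f 0)), P.complex_d_comp_π_f_zero⟩
  have h0 : Limits.IsZero ((P.complex.linearYonedaObj R K).homology 0) :=
    (ModuleCat.isZero_of_subsingleton (extMod R X K 0)).of_iso (P.isoExt (R := R) 0 K).symm
  rw [← HomologicalComplex.exactAt_iff_isZero_homology, HomologicalComplex.exactAt_iff' _ 0 0 1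
    (by simp) (by simp), ShortComplex.moduleCat_exact_iff] at h0
  obtain ⟨y, hy⟩ := h0 (ε ≫ f) (by
    change P.complex.d 1 0 ≫ ε ≫ f = 0
    rw [reassoc_of% hdε, Limits.zero_comp])
  have hd : (P.complex.linearYonedaObj R K).d 0 0 = 0 := HomologicalComplex.shape _ _ _ (by simp)
  have hy0 : ε ≫ f = 0 := by
    rw [← hy]
    change (P.complex.linearYonedaObj R K).d 0 0 y = 0
    rw [hd]
    rfl
  exact Limits.zero_of_epi_comp _ hy0

/-- If `Hom(R/m, K) = 0`, then no nonzero element of `K` is killed by a power of `m`. -/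
theorem eq_zero_of_pow_smul_eq_zero {R K : Type*} [CommRing R] [AddCommGroup K] [Module R K]
    {m : Ideal R} (h : ∀ f : (R ⧸ m) →ₗ[R] K, f = 0) (n : ℕ) (k : K)
    (hk : ∀ x ∈ m ^ n, x • k = 0) : k = 0 := by
  induction n generalizing k with
  | zero => simpa using hk 1 (by simp)
  | succ n ih =>
    refine ih k fun x hx => ?_
    have hle : m ≤ LinearMap.ker (LinearMap.toSpanSingleton R K (x • k)) := fun y hy => by
      rw [LinearMap.mem_ker, LinearMap.toSpanSingleton_apply, smul_smul]
      exact hk _ (by rw [pow_succ']; exact Ideal.mul_mem_mul hy hx)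
    have h1 := LinearMap.congr_fun (h (m.liftQ _ hle)) (Submodule.Quotient.mk 1)
    rwa [Submodule.liftQ_apply, LinearMap.toSpanSingleton_apply, one_smul] at h1

/-- If every `x ⊗ f` can be rewritten as `a ⊗ g` in the tensor product of two finite modules over
a local ring, then `a` generates the first factor or the second factor vanishes. -/
theorem span_singleton_eq_top_of_forall_tmul {R M N : Type*} [CommRing R] [IsLocalRing R]
    [AddCommGroup M] [Module R M] [Module.Finite R M] [AddCommGroup N] [Module R N]
    [Module.Finite R N] [Nontrivial N] (a : M)
    (h : ∀ (x : M) (f : N), ∃ g : N, x ⊗ₜ[R] f = a ⊗ₜ[R] g) :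
    Submodule.span R {a} = ⊤ := by
  by_contra hne
  obtain ⟨p, hp, hap⟩ := (eq_top_or_exists_le_coatom (Submodule.span R {a})).resolve_left hne
  have : IsSimpleModule R (M ⧸ p) := isSimpleModule_iff_isCoatom.mpr hp
  obtain ⟨J, hJ, ⟨e⟩⟩ := isSimpleModule_iff_quot_maximal.mp this
  obtain rfl := IsLocalRing.eq_maximalIdeal hJ
  have hsub : Subsingleton (IsLocalRing.ResidueField R ⊗[R] N) := by
    refine subsingleton_of_forall_eq 0 fun t => ?_
    induction t with
    | zero => rfl
    | add s t hs ht => rw [hs, ht, add_zero]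
    | tmul z f =>
      obtain ⟨x, hx⟩ := p.mkQ_surjective (e.symm z)
      obtain ⟨g, hg⟩ := h x f
      have hg' := congrArg (TensorProduct.map (e.toLinearMap ∘ₗ p.mkQ) LinearMap.id) hg
      have ha : p.mkQ a = 0 := by
        simpa using hap (Submodule.mem_span_singleton_self a)
      simp only [TensorProduct.map_tmul, LinearMap.comp_apply, hx, ha, LinearEquiv.coe_coe,
        map_zero, TensorProduct.zero_tmul, LinearMap.id_apply] at hg'
      rwa [show e (e.symm z) = z from e.apply_symm_apply z] at hg'
  exact not_subsingleton N (IsLocalRing.subsingleton_tensorProduct.mp hsub)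

/-- Multiplication by `x / a` on an ideal `I` with `I² = aI`, where `x ∈ I` and `a` is a
nonzerodivisor. -/
theorem exists_mul_div_linearMap {R : Type*} [CommRing R] {I : Ideal R} {a : R}
    (ha : a ∈ nonZeroDivisors R) (hsq : I ^ 2 = Ideal.span {a} * I) (x : I) :
    ∃ μ : I →ₗ[R] I, ∀ y : I, a • μ y = (x : R) • y := by
  have hex : ∀ y : I, ∃ z : I, a • z = (x : R) • y := fun y => by
    have hxy : (x * y : R) ∈ Ideal.span {a} * I := by
      rw [← hsq, sq]
      exact Ideal.mul_mem_mul x.2 y.2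
    obtain ⟨z, hz, h⟩ := Ideal.mem_span_singleton_mul.mp hxy
    exact ⟨⟨z, hz⟩, Subtype.ext h⟩
  choose μ hμ using hex
  have hinj : ∀ s t : I, a • s = a • t → s = t := fun s t h =>
    Subtype.ext ((mul_cancel_left_mem_nonZeroDivisors ha).mp (congrArg Subtype.val h))
  exact ⟨{  toFun := μ
            map_add' := fun y z => hinj _ _ (by rw [smul_add, hμ, hμ, hμ, smul_add])
            map_smul' := fun r y => hinj _ _ (by
              rw [RingHom.id_apply, hμ, smul_comm a r, hμ, smul_comm]) }, hμ⟩

/-- If `I² = aI` with `a ∈ I` a nonzerodivisor and `I ⊗ Hom(I, K)` is torsionfree, then every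
simple tensor is of the form `a ⊗ g`. -/
theorem exists_tmul_eq_of_torsion_eq_bot {R K : Type*} [CommRing R] [AddCommGroup K] [Module R K]
    {I : Ideal R} {a : R} (ha : a ∈ nonZeroDivisors R) (haI : a ∈ I)
    (hsq : I ^ 2 = Ideal.span {a} * I)
    (htf : Submodule.torsion R (I ⊗[R] (I →ₗ[R] K)) = ⊥) (x : I) (f : I →ₗ[R] K) :
    ∃ g : I →ₗ[R] K, x ⊗ₜ[R] f = (⟨a, haI⟩ : I) ⊗ₜ[R] g := by
  obtain ⟨μ, hμ⟩ := exists_mul_div_linearMap ha hsq x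
  refine ⟨f ∘ₗ μ, ?_⟩
  have hf : a • (f ∘ₗ μ) = (x : R) • f := LinearMap.ext fun y => by
    rw [LinearMap.smul_apply, LinearMap.comp_apply, ← map_smul, hμ, map_smul, LinearMap.smul_apply]
  have hxa : (x : R) • (⟨a, haI⟩ : I) = a • x := Subtype.ext (mul_comm _ _)
  have hmem : x ⊗ₜ[R] f - (⟨a, haI⟩ : I) ⊗ₜ[R] (f ∘ₗ μ) ∈
      Submodule.torsion R (I ⊗[R] (I →ₗ[R] K)) := by
    refine (Submodule.mem_torsion_iff _).mpr ⟨⟨a, ha⟩, ?_⟩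
    rw [Submonoid.mk_smul, smul_sub, ← TensorProduct.tmul_smul a (⟨a, haI⟩ : I), hf,
      TensorProduct.tmul_smul, TensorProduct.smul_tmul', TensorProduct.smul_tmul', hxa, sub_self]
  rw [htf, Submodule.mem_bot] at hmem
  exact sub_eq_zero.mp hmem

/-- Let `R` be a one-dimensional Cohen–Macaulay local ring with canonical
module `K`, and let `I` be an `m`-primary ideal with `I² = aI` for some `a ∈ I`.
If `I ⊗_R Hom_R(I, K)` is torsionfree, then `I = aR`. -/
theorem stmt3 (R : Type u) [CommRing R] [IsLocalRing R]
    (hCM : IsOneDimCMLocal R)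
    (K : Type u) [AddCommGroup K] [Module R K]
    (hK : IsCanonicalModuleAt R (IsLocalRing.maximalIdeal R) K)
    (I : Ideal R) (hprim : ∃ n : ℕ, IsLocalRing.maximalIdeal R ^ n ≤ I)
    (a : R) (ha : a ∈ I) (hsq : I ^ 2 = Ideal.span {a} * I)
    (htf : Submodule.torsion R (↥I ⊗[R] (↥I →ₗ[R] K)) = ⊥) :
    I = Ideal.span {a} := by
  have hNoeth := hCM.1
  obtain ⟨n, hn⟩ := hprim
  obtain ⟨-, -, x, hxm, hx⟩ := hCM
  obtain ⟨hKfin, hExt, ⟨e⟩⟩ := hK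
  have ha_nzd : a ∈ nonZeroDivisors R := by
    have hmem : (x ^ n) ^ 2 ∈ Ideal.span {a} * I := by
      rw [← hsq]
      exact Ideal.pow_mem_pow (hn (Ideal.pow_mem_pow hxm n)) 2
    obtain ⟨z, -, hz⟩ := Ideal.mem_span_singleton_mul.mp hmem
    have hpow : a * z ∈ nonZeroDivisors R := hz ▸ pow_mem (pow_mem hx n) 2
    exact (mul_mem_nonZeroDivisors.mp hpow).1
  have hKnt : Nontrivial K := nontrivial_of_nontrivial_extMod
    (X := ModuleCat.of R (R ⧸ IsLocalRing.maximalIdeal R)) (K := ModuleCat.of R K) (n := 1)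
    e.toLinearEquiv.toEquiv.nontrivial
  have hHom (f : (R ⧸ IsLocalRing.maximalIdeal R) →ₗ[R] K) : f = 0 :=
    congrArg ModuleCat.Hom.hom
      (hom_eq_zero_of_subsingleton_extMod_zero (hExt 0 zero_ne_one) (ModuleCat.ofHom f))
  have hNt : Nontrivial (I →ₗ[R] K) := by
    obtain ⟨k, hk⟩ := exists_ne (0 : K)
    refine nontrivial_of_ne ((LinearMap.toSpanSingleton R K k) ∘ₗ I.subtype) 0 fun h => hk ?_
    exact eq_zero_of_pow_smul_eq_zero hHom n k fun y hy => LinearMap.congr_fun h ⟨y, hn hy⟩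
  have htop := span_singleton_eq_top_of_forall_tmul (⟨a, ha⟩ : I)
    (exists_tmul_eq_of_torsion_eq_bot ha_nzd ha hsq htf)
  have hmap := congrArg (Submodule.map I.subtype) htop
  rw [Submodule.map_span, Set.image_singleton, Submodule.map_subtype_top] at hmap
  exact hmap.symm

end
end
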